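/- For every integer g ≥ 1, every integer i with 0 ≤ i ≤ min(g,4), every γ = [[A,B],[C,D]] ∈ Sp(2g,ℤ) and every τ ∈ ℍ_g: S_{i,2^{4−i}}^g(γ∘τ) = det(Cτ+D)⁸·S_{i,2^{4−i}}^g(τ); that is, S_{i,2^{4−i}}^g is a modular form of weight 8 with respect to the full symplectic group Sp(2g,ℤ). -/

import Mathlib

open scoped BigOperators

noncomputable section

/-- The Siegel upper half-space: symmetric complex matrices with positive
definite imaginary part (indexed by a finite type `ι`). -/
def Siegel (ι : Type) [Fintype ι] : Set (Matrix ι ι ℂ) :=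
  {τ | τ.IsSymm ∧ ∀ v : ι → ℝ, v ≠ 0 → 0 < ∑ i, ∑ j, v i * (τ i j).im * v j}

/-- The theta function with characteristic `[ε, δ]`. -/
def theta {ι : Type} [Fintype ι] (ε δ : ι → ZMod 2) (τ : Matrix ι ι ℂ) (z : ι → ℂ) : ℂ :=
  ∑' n : ι → ℤ, Complex.exp ((Real.pi : ℂ) * Complex.I *
    ((∑ i, ∑ j, ((n i : ℂ) + ((ε i).val : ℂ) / 2) * τ i j * ((n j : ℂ) + ((ε j).val : ℂ) / 2)) +
     2 * ∑ i, ((n i : ℂ) + ((ε i).val : ℂ) / 2) * (z i + ((δ i).val : ℂ) / 2)))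

/-- A theta characteristic, an element of `𝔽₂^{2g}`. -/
abbrev Char2 (ι : Type) := (ι → ZMod 2) × (ι → ZMod 2)

/-- Theta function, with the characteristic as a pair. -/
def thetaChar {ι : Type} [Fintype ι] (m : Char2 ι) (τ : Matrix ι ι ℂ) (z : ι → ℂ) : ℂ :=
  theta m.1 m.2 τ z

/-- Theta constant. -/
def thetaConst {ι : Type} [Fintype ι] (m : Char2 ι) (τ : Matrix ι ι ℂ) : ℂ :=
  thetaChar m τ 0

/-- `W` is (the underlying finite set of) an `i`-dimensional affine subspace of `𝔽₂^{2g}`,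
i.e. a coset of an `i`-dimensional linear subspace. -/
def IsAffineCosetDim {ι : Type} [Fintype ι] (i : ℕ) (W : Finset (Char2 ι)) : Prop :=
  ∃ (V : Submodule (ZMod 2) (Char2 ι)) (x : Char2 ι),
    Module.finrank (ZMod 2) V = i ∧ (W : Set (Char2 ι)) = (fun v => x + v) '' (V : Set (Char2 ι))

/-- The modular form `S_{i,s}^g(τ) = Σ_W (Π_{w∈W} θ_w(τ))^s`, the sum over all
`i`-dimensional affine subspaces `W` of `𝔽₂^{2g}`, each counted once. -/
noncomputable def Sform (ι : Type) [Fintype ι] (i s : ℕ) (τ : Matrix ι ι ℂ) : ℂ :=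
  letI := Classical.propDecidable
  ∑ W ∈ Finset.univ.filter (fun W : Finset (Char2 ι) => IsAffineCosetDim i W),
    (∏ w ∈ W, thetaConst w τ) ^ s

/-- The standard symplectic form `J`. -/
def symplJ (g : ℕ) : Matrix (Fin g ⊕ Fin g) (Fin g ⊕ Fin g) ℤ :=
  Matrix.fromBlocks 0 1 (-1) 0

/-- The block matrix `[[A,B],[C,D]]` is in `Sp(2g,ℤ)`. -/
def IsSymplectic {g : ℕ} (A B C D : Matrix (Fin g) (Fin g) ℤ) : Prop :=
  Matrix.fromBlocks A B C D * symplJ g * (Matrix.fromBlocks A B C D).transpose = symplJ g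

/-- The block matrix `[[A,B],[C,D]]` is in Igusa's subgroup `Γ_g(1,2) ⊂ Sp(2g,ℤ)`:
symplectic, with `diag(ABᵀ) ≡ diag(CDᵀ) ≡ 0 mod 2`. -/
def InGammaOneTwo {g : ℕ} (A B C D : Matrix (Fin g) (Fin g) ℤ) : Prop :=
  IsSymplectic A B C D ∧ (∀ i, (A * B.transpose) i i % 2 = 0) ∧ (∀ i, (C * D.transpose) i i % 2 = 0)

/-- The action `γ∘τ = (Aτ+B)(Cτ+D)⁻¹` of `Sp(2g,ℤ)` on the Siegel upper half-space. -/
noncomputable def symplAction {g : ℕ} (A B C D : Matrix (Fin g) (Fin g) ℤ)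
    (τ : Matrix (Fin g) (Fin g) ℂ) : Matrix (Fin g) (Fin g) ℂ :=
  (A.map (Int.cast : ℤ → ℂ) * τ + B.map (Int.cast : ℤ → ℂ)) *
    (C.map (Int.cast : ℤ → ℂ) * τ + D.map (Int.cast : ℤ → ℂ))⁻¹

namespace SymplecticGroup

open Matrix

variable {ι : Type*} [DecidableEq ι]

/-- The symmetric matrix with entry `q` at the positions `(k, l)` and `(l, k)`. -/
def elemSymm (k l : ι) (q : ℤ) : Matrix ι ι ℤ :=
  Matrix.of fun i j => if (i = k ∧ j = l) ∨ (i = l ∧ j = k) then q else 0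

lemma elemSymm_isSymm (k l : ι) (q : ℤ) : (elemSymm k l q).IsSymm := by
  ext i j
  simp only [elemSymm, transpose_apply, of_apply]
  congr 1
  exact propext (by tauto)

variable [Fintype ι]

/-- The translation `τ ↦ τ + B` attached to a symmetric integral matrix `B`. -/
def translation (B : Matrix ι ι ℤ) (hB : B.IsSymm) : symplecticGroup ι ℤ :=
  ⟨fromBlocks 1 B 0 1, by rw [fromBlocks_mem_iff]; simp [hB.eq]⟩

/-- The inversion in the coordinates belonging to the set `s`. -/
def inversion (s : Finset ι) : symplecticGroup ι ℤ :=
  ⟨fromBlocks (diagonal fun i => if i ∈ s then 0 else 1) (diagonal fun i => if i ∈ s then -1 else 0)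
    (diagonal fun i => if i ∈ s then 1 else 0) (diagonal fun i => if i ∈ s then 0 else 1), by
    rw [fromBlocks_mem_iff]
    simp only [diagonal_transpose, diagonal_mul_diagonal, diagonal_sub]
    refine ⟨?_, ?_, ?_⟩
    · congr 1; ext i; split_ifs <;> simp
    · congr 1; ext i; split_ifs <;> simp
    · rw [← diagonal_one]; congr 1; ext i; split_ifs <;> simp⟩

lemma translation_mulVec_inl (B : Matrix ι ι ℤ) (hB : B.IsSymm) (v : ι ⊕ ι → ℤ) (i : ι) :
    ((translation B hB : Matrix (ι ⊕ ι) (ι ⊕ ι) ℤ) *ᵥ v) (Sum.inl i) =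
      v (Sum.inl i) + ∑ j, B i j * v (Sum.inr j) := by
  simp [translation, mulVec, dotProduct, Matrix.one_apply]

lemma translation_mulVec_inr (B : Matrix ι ι ℤ) (hB : B.IsSymm) (v : ι ⊕ ι → ℤ) (i : ι) :
    ((translation B hB : Matrix (ι ⊕ ι) (ι ⊕ ι) ℤ) *ᵥ v) (Sum.inr i) = v (Sum.inr i) := by
  simp [translation, fromBlocks_mulVec]

lemma elemSymm_mulVec (k l : ι) (q : ℤ) (y : ι → ℤ) (i : ι) :
    ∑ j, elemSymm k l q i j * y j =
      (if i = k then q * y l else 0) + (if i = l ∧ k ≠ l then q * y k else 0) := by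
  have h : ∀ j, elemSymm k l q i j * y j = (if j = l then (if i = k then q * y l else 0) else 0) +
      (if j = k then (if i = l ∧ k ≠ l then q * y k else 0) else 0) := by
    intro j
    simp only [elemSymm, of_apply]
    by_cases h1 : i = k <;> by_cases h2 : i = l <;> by_cases h3 : j = l <;> by_cases h4 : j = k <;>
      simp_all
  simp only [h, Finset.sum_add_distrib, Finset.sum_ite_eq', Finset.mem_univ, if_true]

lemma inversion_mulVec_inl (s : Finset ι) (v : ι ⊕ ι → ℤ) (i : ι) :
    ((inversion s : Matrix (ι ⊕ ι) (ι ⊕ ι) ℤ) *ᵥ v) (Sum.inl i) =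
      if i ∈ s then -v (Sum.inr i) else v (Sum.inl i) := by
  simp only [inversion, fromBlocks_mulVec, Sum.elim_inl, Pi.add_apply, mulVec_diagonal,
    Function.comp_apply]
  split_ifs <;> simp

lemma inversion_mulVec_inr (s : Finset ι) (v : ι ⊕ ι → ℤ) (i : ι) :
    ((inversion s : Matrix (ι ⊕ ι) (ι ⊕ ι) ℤ) *ᵥ v) (Sum.inr i) =
      if i ∈ s then v (Sum.inl i) else v (Sum.inr i) := by
  simp only [inversion, fromBlocks_mulVec, Sum.elim_inr, Pi.add_apply, mulVec_diagonal,
    Function.comp_apply]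
  split_ifs <;> simp

lemma ext_mulVec {γ δ : symplecticGroup ι ℤ}
    (h : ∀ v : ι ⊕ ι → ℤ, (γ : Matrix (ι ⊕ ι) (ι ⊕ ι) ℤ) *ᵥ v = (δ : Matrix _ _ ℤ) *ᵥ v) :
    γ = δ :=
  Subtype.ext (Matrix.ext_of_mulVec_single fun _ => h _)

lemma inv_mulVec_mulVec (γ : symplecticGroup ι ℤ) (v : ι ⊕ ι → ℤ) :
    ((γ⁻¹ : symplecticGroup ι ℤ) : Matrix (ι ⊕ ι) (ι ⊕ ι) ℤ) *ᵥ
      ((γ : Matrix (ι ⊕ ι) (ι ⊕ ι) ℤ) *ᵥ v) = v := by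
  rw [mulVec_mulVec, ← Submonoid.coe_mul, inv_mul_cancel, Submonoid.coe_one, one_mulVec]

lemma mul_mulVec (γ δ : symplecticGroup ι ℤ) (v : ι ⊕ ι → ℤ) :
    ((γ * δ : symplecticGroup ι ℤ) : Matrix (ι ⊕ ι) (ι ⊕ ι) ℤ) *ᵥ v =
      (γ : Matrix (ι ⊕ ι) (ι ⊕ ι) ℤ) *ᵥ ((δ : Matrix (ι ⊕ ι) (ι ⊕ ι) ℤ) *ᵥ v) := by
  rw [mulVec_mulVec, ← Submonoid.coe_mul]

lemma inversion_insert {k : ι} {s : Finset ι} (hk : k ∉ s) :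
    inversion (insert k s) = inversion {k} * inversion s := by
  refine ext_mulVec fun v => ?_
  rw [mul_mulVec]
  ext (i | i)
  · simp only [inversion_mulVec_inl, inversion_mulVec_inr, Finset.mem_insert, Finset.mem_singleton]
    grind
  · simp only [inversion_mulVec_inl, inversion_mulVec_inr, Finset.mem_insert, Finset.mem_singleton]
    grind

lemma translation_add (B B' : Matrix ι ι ℤ) (hB : B.IsSymm) (hB' : B'.IsSymm) :
    translation (B + B') (hB.add hB') = translation B hB * translation B' hB' := by
  refine ext_mulVec fun v => ?_
  rw [mul_mulVec]
  ext (i | i)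
  · simp only [translation_mulVec_inl, translation_mulVec_inr, Matrix.add_apply, add_mul,
      Finset.sum_add_distrib]
    ring
  · simp only [translation_mulVec_inr]

lemma translation_zero : translation (0 : Matrix ι ι ℤ) isSymm_zero = 1 := by
  refine ext_mulVec fun v => ?_
  ext (i | i)
  · simp [translation_mulVec_inl]
  · simp [translation_mulVec_inr]

lemma inversion_empty : inversion (∅ : Finset ι) = 1 := by
  refine ext_mulVec fun v => ?_
  ext (i | i)
  · simp [inversion_mulVec_inl]
  · simp [inversion_mulVec_inr]

lemma inversion_mem {H : Subgroup (symplecticGroup ι ℤ)} (s : Finset ι)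
    (hJ : ∀ k ∈ s, inversion {k} ∈ H) : inversion s ∈ H := by
  induction s using Finset.induction_on with
  | empty => rw [inversion_empty]; exact H.one_mem
  | insert k s hk ih =>
    rw [inversion_insert hk]
    exact H.mul_mem (hJ k (Finset.mem_insert_self k s))
      (ih fun l hl => hJ l (Finset.mem_insert_of_mem hl))

/-- The integral symmetric matrices whose translation lies in `H`. -/
def translationSubgroup (H : Subgroup (symplecticGroup ι ℤ)) : AddSubgroup (Matrix ι ι ℤ) where
  carrier := {B | ∃ hB : B.IsSymm, translation B hB ∈ H}
  zero_mem' := ⟨isSymm_zero, by rw [translation_zero]; exact H.one_mem⟩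
  add_mem' := by
    rintro B B' ⟨hB, h⟩ ⟨hB', h'⟩
    exact ⟨hB.add hB', by rw [translation_add _ _ hB hB']; exact H.mul_mem h h'⟩
  neg_mem' := by
    rintro B ⟨hB, h⟩
    refine ⟨hB.neg, ?_⟩
    have : translation (-B) hB.neg = (translation B hB)⁻¹ := by
      rw [eq_inv_iff_mul_eq_one, ← translation_add]
      simp only [neg_add_cancel, translation_zero]
    rw [this]
    exact H.inv_mem h

lemma translation_elemSymm_mem {H : Subgroup (symplecticGroup ι ℤ)} {k l : ι}
    (h : translation (elemSymm k l 1) (elemSymm_isSymm k l 1) ∈ H) (q : ℤ) :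
    translation (elemSymm k l q) (elemSymm_isSymm k l q) ∈ H := by
  have h1 : elemSymm k l 1 ∈ translationSubgroup H := ⟨_, h⟩
  have h2 : elemSymm k l q = q • elemSymm k l 1 := by
    ext i j
    simp [elemSymm]
  obtain ⟨_, h3⟩ : elemSymm k l q ∈ translationSubgroup H := h2 ▸ zsmul_mem h1 q
  exact h3

end SymplecticGroup

namespace SymplecticGroup

open Matrix

variable {ι : Type*} [Fintype ι]

/-- The sum of the absolute values of the entries of an integral vector. -/
def absSum (v : ι ⊕ ι → ℤ) : ℕ := ∑ a, (v a).natAbs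

variable [DecidableEq ι]

/-- The vector `u` has the smallest sum of absolute values in its `H`-orbit. -/
def IsOrbitMin (H : Subgroup (symplecticGroup ι ℤ)) (u : ι ⊕ ι → ℤ) : Prop :=
  ∀ h ∈ H, absSum u ≤ absSum ((h : Matrix (ι ⊕ ι) (ι ⊕ ι) ℤ) *ᵥ u)

lemma natAbs_le_of_absSum_le_update {u : ι ⊕ ι → ℤ} {a : ι ⊕ ι} {c : ℤ}
    (h : absSum u ≤ absSum (Function.update u a c)) : (u a).natAbs ≤ c.natAbs := by
  unfold absSum at h
  rw [← Finset.add_sum_erase _ _ (Finset.mem_univ a),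
    ← Finset.add_sum_erase Finset.univ _ (Finset.mem_univ a), Function.update_self] at h
  have : ∑ x ∈ Finset.univ.erase a, (Function.update u a c x).natAbs =
      ∑ x ∈ Finset.univ.erase a, (u x).natAbs :=
    Finset.sum_congr rfl fun x hx => by
      rw [Function.update_of_ne (Finset.ne_of_mem_erase hx)]
  omega

lemma absSum_inversion (k : ι) (v : ι ⊕ ι → ℤ) :
    absSum ((inversion {k} : Matrix (ι ⊕ ι) (ι ⊕ ι) ℤ) *ᵥ v) = absSum v := by
  unfold absSum
  rw [Fintype.sum_sum_type, Fintype.sum_sum_type, ← Finset.sum_add_distrib,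
    ← Finset.sum_add_distrib]
  refine Finset.sum_congr rfl fun i _ => ?_
  rw [inversion_mulVec_inl, inversion_mulVec_inr]
  split_ifs
  · rw [Int.natAbs_neg, add_comm]
  · rfl

lemma exists_isOrbitMin (H : Subgroup (symplecticGroup ι ℤ)) (v : ι ⊕ ι → ℤ) :
    ∃ h ∈ H, IsOrbitMin H ((h : Matrix (ι ⊕ ι) (ι ⊕ ι) ℤ) *ᵥ v) := by
  classical
  have hex : ∃ n, ∃ h ∈ H, absSum ((h : Matrix (ι ⊕ ι) (ι ⊕ ι) ℤ) *ᵥ v) = n :=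
    ⟨_, 1, H.one_mem, rfl⟩
  obtain ⟨h, hh, hn⟩ := Nat.find_spec hex
  refine ⟨h, hh, fun h' hh' => ?_⟩
  rw [hn, ← mul_mulVec]
  exact Nat.find_min' hex ⟨_, H.mul_mem hh' hh, rfl⟩

lemma IsOrbitMin.inversion_mulVec {H : Subgroup (symplecticGroup ι ℤ)} {u : ι ⊕ ι → ℤ}
    (hu : IsOrbitMin H u) {k : ι} (hk : inversion {k} ∈ H) :
    IsOrbitMin H ((SymplecticGroup.inversion {k} : Matrix (ι ⊕ ι) (ι ⊕ ι) ℤ) *ᵥ u) := by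
  intro h hh
  rw [absSum_inversion, ← mul_mulVec]
  exact hu _ (H.mul_mem hh hk)

lemma IsOrbitMin.two_mul_le {H : Subgroup (symplecticGroup ι ℤ)} {u : ι ⊕ ι → ℤ}
    (hu : IsOrbitMin H u) {k l : ι}
    (hT : ∀ q, translation (elemSymm k l q) (elemSymm_isSymm k l q) ∈ H)
    (hkl : k ≠ l → u (Sum.inr k) = 0) (hl : u (Sum.inr l) ≠ 0) :
    2 * (u (Sum.inl k)).natAbs ≤ (u (Sum.inr l)).natAbs := by
  have key : ∀ q : ℤ, (u (Sum.inl k)).natAbs ≤ (u (Sum.inl k) + q * u (Sum.inr l)).natAbs := by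
    intro q
    have h := hu _ (hT q)
    have e : (translation (elemSymm k l q) (elemSymm_isSymm k l q) : Matrix (ι ⊕ ι) (ι ⊕ ι) ℤ) *ᵥ u
        = Function.update u (Sum.inl k) (u (Sum.inl k) + q * u (Sum.inr l)) := by
      ext (i | i)
      · rw [translation_mulVec_inl, elemSymm_mulVec]
        by_cases hik : i = k
        · subst hik
          grind
        · rw [Function.update_of_ne (by simpa using hik)]
          grind
      · rw [translation_mulVec_inr, Function.update_of_ne (by simp)]
    rw [e] at h
    exact natAbs_le_of_absSum_le_update h
  have h1 := key 1
  have h2 := key (-1)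
  omega

section Reduction

variable {H : Subgroup (symplecticGroup ι ℤ)} {S : Set ι}

lemma IsOrbitMin.eq_zero_or_eq_zero {u : ι ⊕ ι → ℤ}
    (hT : ∀ k ∉ S, ∀ l ∉ S, ∀ q, translation (elemSymm k l q) (elemSymm_isSymm k l q) ∈ H)
    (hJ : ∀ k ∉ S, SymplecticGroup.inversion {k} ∈ H)
    (hu : IsOrbitMin H u) {k : ι} (hk : k ∉ S) : u (Sum.inl k) = 0 ∨ u (Sum.inr k) = 0 := by
  by_contra! hne
  have h1 := hu.two_mul_le (hT k hk k hk) (fun h => absurd rfl h) hne.2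
  have h2 := (hu.inversion_mulVec (hJ k hk)).two_mul_le (hT k hk k hk) (fun h => absurd rfl h)
    (by rw [inversion_mulVec_inr, if_pos (Finset.mem_singleton_self k)]; exact hne.1)
  rw [inversion_mulVec_inr, inversion_mulVec_inl, if_pos (Finset.mem_singleton_self k),
    if_pos (Finset.mem_singleton_self k)] at h2
  omega

lemma IsOrbitMin.eq_zero_of_ne_zero {u : ι ⊕ ι → ℤ}
    (hT : ∀ k ∉ S, ∀ l ∉ S, ∀ q, translation (elemSymm k l q) (elemSymm_isSymm k l q) ∈ H)
    (hJ : ∀ k ∉ S, SymplecticGroup.inversion {k} ∈ H)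
    (hu : IsOrbitMin H u) {k l : ι} (hk : k ∉ S) (hl : l ∉ S) (hkl : k ≠ l)
    (h : u (Sum.inl k) ≠ 0) : u (Sum.inr l) = 0 := by
  by_contra hne
  have hk0 := (hu.eq_zero_or_eq_zero hT hJ hk).resolve_left h
  have hl0 := (hu.eq_zero_or_eq_zero hT hJ hl).resolve_right hne
  have h1 := hu.two_mul_le (hT k hk l hl) (fun _ => hk0) hne
  have h2 := ((hu.inversion_mulVec (hJ k hk)).inversion_mulVec (hJ l hl)).two_mul_le (hT l hl k hk)
    (fun _ => by simp [inversion_mulVec_inr, inversion_mulVec_inl, hkl.symm, hl0])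
    (by simp [inversion_mulVec_inr, hkl, h])
  simp [inversion_mulVec_inr, inversion_mulVec_inl, hkl, hkl.symm] at h2
  omega

/-- In an orbit-minimal vector all entries outside a single index `k` vanish. -/
lemma IsOrbitMin.eq_zero_of_ne {u : ι ⊕ ι → ℤ}
    (hT : ∀ k ∉ S, ∀ l ∉ S, ∀ q, translation (elemSymm k l q) (elemSymm_isSymm k l q) ∈ H)
    (hJ : ∀ k ∉ S, SymplecticGroup.inversion {k} ∈ H)
    (hu : IsOrbitMin H u) {k l : ι} (hk : k ∉ S) (hl : l ∉ S) (hkl : k ≠ l)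
    (h : u (Sum.inl k) ≠ 0) : u (Sum.inl l) = 0 ∧ u (Sum.inr l) = 0 := by
  refine ⟨?_, hu.eq_zero_of_ne_zero hT hJ hk hl hkl h⟩
  have := (hu.inversion_mulVec (hJ l hl)).eq_zero_of_ne_zero hT hJ hk hl hkl
    (by simpa [inversion_mulVec_inl, hkl] using h)
  simpa [inversion_mulVec_inr] using this

lemma exists_mulVec_eq_single_inl {v : ι ⊕ ι → ℤ}
    (hT : ∀ k ∉ S, ∀ l ∉ S, ∀ q, translation (elemSymm k l q) (elemSymm_isSymm k l q) ∈ H)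
    (hJ : ∀ k ∉ S, inversion {k} ∈ H)
    (hH : ∀ h ∈ H, ∀ w : ι ⊕ ι → ℤ, (∀ j ∈ S, w (Sum.inl j) = 0 ∧ w (Sum.inr j) = 0) →
      ∀ j ∈ S, ((h : Matrix (ι ⊕ ι) (ι ⊕ ι) ℤ) *ᵥ w) (Sum.inl j) = 0 ∧
        ((h : Matrix (ι ⊕ ι) (ι ⊕ ι) ℤ) *ᵥ w) (Sum.inr j) = 0)
    (hv : ∀ j ∈ S, v (Sum.inl j) = 0 ∧ v (Sum.inr j) = 0) (hv0 : v ≠ 0) :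
    ∃ k ∉ S, ∃ h ∈ H, ∃ c : ℤ,
      (h : Matrix (ι ⊕ ι) (ι ⊕ ι) ℤ) *ᵥ v = c • Pi.single (Sum.inl k) 1 := by
  have aux : ∀ h ∈ H, IsOrbitMin H ((h : Matrix (ι ⊕ ι) (ι ⊕ ι) ℤ) *ᵥ v) →
      ∀ k, ((h : Matrix (ι ⊕ ι) (ι ⊕ ι) ℤ) *ᵥ v) (Sum.inl k) ≠ 0 → ∃ k ∉ S, ∃ h ∈ H, ∃ c : ℤ,
      (h : Matrix (ι ⊕ ι) (ι ⊕ ι) ℤ) *ᵥ v = c • Pi.single (Sum.inl k) 1 := by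
    intro h hh hu k hk
    have hkS : k ∉ S := fun hkS => hk (hH h hh v hv k hkS).1
    refine ⟨k, hkS, h, hh, ((h : Matrix (ι ⊕ ι) (ι ⊕ ι) ℤ) *ᵥ v) (Sum.inl k), funext ?_⟩
    rintro (l | l)
    · by_cases hlk : l = k
      · subst hlk
        rw [Pi.smul_apply, Pi.single_eq_same, smul_eq_mul, mul_one]
      · rw [Pi.smul_apply, Pi.single_eq_of_ne (by simpa using hlk), smul_zero]
        by_cases hl : l ∈ S
        · exact (hH h hh v hv l hl).1
        · exact (hu.eq_zero_of_ne hT hJ hkS hl (Ne.symm hlk) hk).1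
    · rw [Pi.smul_apply, Pi.single_eq_of_ne (by simp), smul_zero]
      by_cases hl : l ∈ S
      · exact (hH h hh v hv l hl).2
      · by_cases hlk : l = k
        · subst hlk
          exact (hu.eq_zero_or_eq_zero hT hJ hkS).resolve_left hk
        · exact (hu.eq_zero_of_ne hT hJ hkS hl (Ne.symm hlk) hk).2
  obtain ⟨h, hh, hu⟩ := exists_isOrbitMin H v
  have hu0 : (h : Matrix (ι ⊕ ι) (ι ⊕ ι) ℤ) *ᵥ v ≠ 0 := fun h0 => hv0 <| by
    rw [← inv_mulVec_mulVec h v, h0, mulVec_zero]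
  obtain ⟨k | k, hk⟩ := Function.ne_iff.mp hu0
  · exact aux h hh hu k hk
  · have hkS : k ∉ S := fun hkS => hk (hH h hh v hv k hkS).2
    refine aux (inversion {k} * h) (H.mul_mem (hJ k hkS) hh) ?_ k ?_
    · rw [mul_mulVec]
      exact hu.inversion_mulVec (hJ k hkS)
    · rw [mul_mulVec, inversion_mulVec_inl, if_pos (Finset.mem_singleton_self k)]
      simpa using hk

lemma exists_mulVec_single_inl {k l : ι}
    (hT : translation (elemSymm k l 1) (elemSymm_isSymm k l 1) ∈ H)
    (hk : inversion {k} ∈ H) (hl : inversion {l} ∈ H) :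
    ∃ h ∈ H, ∃ c : ℤ, (h : Matrix (ι ⊕ ι) (ι ⊕ ι) ℤ) *ᵥ Pi.single (Sum.inl k) 1 =
      c • Pi.single (Sum.inl l) 1 := by
  by_cases hkl : k = l
  · subst hkl
    exact ⟨1, H.one_mem, 1, by rw [Submonoid.coe_one, one_mulVec, one_smul]⟩
  refine ⟨inversion {l} * (translation (elemSymm k l 1) (elemSymm_isSymm k l 1) *
    (inversion {k} * (inversion {l} * (translation (elemSymm k l 1) (elemSymm_isSymm k l 1) *
      inversion {k})))), H.mul_mem hl (H.mul_mem hT (H.mul_mem hk (H.mul_mem hl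
        (H.mul_mem hT hk)))), -1, funext ?_⟩
  simp only [mul_mulVec]
  rintro (i | i)
  · simp only [inversion_mulVec_inl, inversion_mulVec_inr, translation_mulVec_inl,
      translation_mulVec_inr, elemSymm_mulVec, Pi.smul_apply, Pi.single_apply,
      Finset.mem_singleton]
    grind
  · simp only [inversion_mulVec_inl, inversion_mulVec_inr, translation_mulVec_inl,
      translation_mulVec_inr, elemSymm_mulVec, Pi.smul_apply, Pi.single_apply,
      Finset.mem_singleton]
    grind

end Reduction

end SymplecticGroup

namespace SymplecticGroup

open Matrix

variable {ι : Type*} [Fintype ι] [DecidableEq ι]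

lemma exists_translation_mulVec_inl_eq_zero {H : Subgroup (symplecticGroup ι ℤ)}
    (hT : ∀ k l, translation (elemSymm k l 1) (elemSymm_isSymm k l 1) ∈ H)
    {v : ι ⊕ ι → ℤ} {k : ι} (hk : v (Sum.inr k) = 1) :
    ∃ (B : Matrix ι ι ℤ) (hB : B.IsSymm), translation B hB ∈ H ∧
      (∀ j ≠ k, v (Sum.inl j) = 0 → ∀ i, B i j = 0) ∧
      ∀ i, ((translation B hB : Matrix (ι ⊕ ι) (ι ⊕ ι) ℤ) *ᵥ v) (Sum.inl i) = 0 := by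
  set b : ι → ℤ := fun j => if j = k then
    -v (Sum.inl k) + ∑ i ∈ Finset.univ.erase k, v (Sum.inl i) * v (Sum.inr i)
    else -v (Sum.inl j) with hb
  have hmem : ∑ j, elemSymm k j (b j) ∈ translationSubgroup H :=
    sum_mem fun j _ => ⟨_, translation_elemSymm_mem (hT k j) (b j)⟩
  have hentry : ∀ i j, (∑ l, elemSymm k l (b l)) i j =
      if j = k then b i else if i = k then b j else 0 := by
    intro i j
    rw [Matrix.sum_apply]
    by_cases hj : j = k
    · subst hj
      rw [Finset.sum_eq_single i]
      · simp [elemSymm]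
      · intro l _ hl
        simp only [elemSymm, of_apply]
        grind
      · simp
    · rw [Finset.sum_eq_single j]
      · simp [elemSymm, hj]
      · intro l _ hl
        simp only [elemSymm, of_apply]
        grind
      · simp
  obtain ⟨hB, hBH⟩ := hmem
  refine ⟨_, hB, hBH, ?_, ?_⟩
  · intro j hj hvj i
    rw [hentry, if_neg hj]
    simp [hb, hj, hvj]
  · intro i
    rw [translation_mulVec_inl, ← Finset.add_sum_erase _ _ (Finset.mem_univ k), hentry, if_pos rfl,
      hk]
    have hsum : ∑ j ∈ Finset.univ.erase k, (∑ l, elemSymm k l (b l)) i j * v (Sum.inr j) =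
        if i = k then - ∑ j ∈ Finset.univ.erase k, v (Sum.inl j) * v (Sum.inr j) else 0 := by
      rw [← Finset.sum_neg_distrib]
      split_ifs with hi
      · refine Finset.sum_congr rfl fun j hj => ?_
        rw [hentry, if_neg (Finset.ne_of_mem_erase hj), if_pos hi]
        simp [hb, Finset.ne_of_mem_erase hj]
      · refine Finset.sum_eq_zero fun j hj => ?_
        rw [hentry, if_neg (Finset.ne_of_mem_erase hj), if_neg hi, zero_mul]
    rw [hsum]
    simp only [hb]
    split_ifs with hi
    · subst hi
      ring
    · ring

/-- `γ` fixes the two standard basis vectors belonging to the index `j`. -/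
def FixesPair (γ : symplecticGroup ι ℤ) (j : ι) : Prop :=
  (γ : Matrix (ι ⊕ ι) (ι ⊕ ι) ℤ) *ᵥ Pi.single (Sum.inl j) 1 = Pi.single (Sum.inl j) 1 ∧
    (γ : Matrix (ι ⊕ ι) (ι ⊕ ι) ℤ) *ᵥ Pi.single (Sum.inr j) 1 = Pi.single (Sum.inr j) 1

lemma FixesPair.mul {γ δ : symplecticGroup ι ℤ} {j : ι} (hγ : FixesPair γ j)
    (hδ : FixesPair δ j) : FixesPair (γ * δ) j := by
  constructor
  · rw [mul_mulVec, hδ.1, hγ.1]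
  · rw [mul_mulVec, hδ.2, hγ.2]

lemma FixesPair.inv {γ : symplecticGroup ι ℤ} {j : ι} (hγ : FixesPair γ j) :
    FixesPair γ⁻¹ j := by
  constructor
  · conv_lhs => rw [← hγ.1, inv_mulVec_mulVec]
  · conv_lhs => rw [← hγ.2, inv_mulVec_mulVec]

lemma fixesPair_one (j : ι) : FixesPair (1 : symplecticGroup ι ℤ) j := by
  constructor <;> rw [Submonoid.coe_one, one_mulVec]

lemma dotProduct_J_mulVec (γ : symplecticGroup ι ℤ) (u v : ι ⊕ ι → ℤ) :
    ((γ : Matrix (ι ⊕ ι) (ι ⊕ ι) ℤ) *ᵥ u) ⬝ᵥ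
      (J ι ℤ *ᵥ ((γ : Matrix (ι ⊕ ι) (ι ⊕ ι) ℤ) *ᵥ v)) = u ⬝ᵥ (J ι ℤ *ᵥ v) := by
  conv_rhs => rw [← mem_iff'.mp γ.2, ← mulVec_mulVec, ← mulVec_mulVec, dotProduct_mulVec,
    vecMul_transpose]

lemma single_inl_dotProduct_J (j : ι) (v : ι ⊕ ι → ℤ) :
    Pi.single (Sum.inl j) 1 ⬝ᵥ (J ι ℤ *ᵥ v) = -v (Sum.inr j) := by
  rw [single_one_dotProduct, J, fromBlocks_mulVec]
  simp [neg_mulVec]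

lemma single_inr_dotProduct_J (j : ι) (v : ι ⊕ ι → ℤ) :
    Pi.single (Sum.inr j) 1 ⬝ᵥ (J ι ℤ *ᵥ v) = v (Sum.inl j) := by
  rw [single_one_dotProduct, J, fromBlocks_mulVec]
  simp

lemma mulVec_inr_of_mulVec_single_inl {γ : symplecticGroup ι ℤ} {j : ι}
    (h : (γ : Matrix (ι ⊕ ι) (ι ⊕ ι) ℤ) *ᵥ Pi.single (Sum.inl j) 1 = Pi.single (Sum.inl j) 1)
    (v : ι ⊕ ι → ℤ) :
    ((γ : Matrix (ι ⊕ ι) (ι ⊕ ι) ℤ) *ᵥ v) (Sum.inr j) = v (Sum.inr j) := by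
  have := dotProduct_J_mulVec γ (Pi.single (Sum.inl j) 1) v
  rw [h, single_inl_dotProduct_J, single_inl_dotProduct_J] at this
  exact neg_inj.mp this

lemma mulVec_inl_of_mulVec_single_inr {γ : symplecticGroup ι ℤ} {j : ι}
    (h : (γ : Matrix (ι ⊕ ι) (ι ⊕ ι) ℤ) *ᵥ Pi.single (Sum.inr j) 1 = Pi.single (Sum.inr j) 1)
    (v : ι ⊕ ι → ℤ) :
    ((γ : Matrix (ι ⊕ ι) (ι ⊕ ι) ℤ) *ᵥ v) (Sum.inl j) = v (Sum.inl j) := by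
  have := dotProduct_J_mulVec γ (Pi.single (Sum.inr j) 1) v
  rwa [h, single_inr_dotProduct_J, single_inr_dotProduct_J] at this

lemma FixesPair.mulVec_eq {γ : symplecticGroup ι ℤ} {j : ι} (h : FixesPair γ j)
    (v : ι ⊕ ι → ℤ) :
    ((γ : Matrix (ι ⊕ ι) (ι ⊕ ι) ℤ) *ᵥ v) (Sum.inl j) = v (Sum.inl j) ∧
      ((γ : Matrix (ι ⊕ ι) (ι ⊕ ι) ℤ) *ᵥ v) (Sum.inr j) = v (Sum.inr j) :=
  ⟨mulVec_inl_of_mulVec_single_inr h.2 v, mulVec_inr_of_mulVec_single_inl h.1 v⟩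

lemma translation_mulVec_single_inl (B : Matrix ι ι ℤ) (hB : B.IsSymm) (j : ι) :
    (translation B hB : Matrix (ι ⊕ ι) (ι ⊕ ι) ℤ) *ᵥ Pi.single (Sum.inl j) 1 =
      Pi.single (Sum.inl j) 1 := by
  ext (i | i)
  · rw [translation_mulVec_inl]
    simp
  · rw [translation_mulVec_inr]

lemma fixesPair_translation {B : Matrix ι ι ℤ} (hB : B.IsSymm) {j : ι}
    (h : ∀ i, B i j = 0) : FixesPair (translation B hB) j := by
  refine ⟨translation_mulVec_single_inl B hB j, ?_⟩
  ext (i | i)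
  · rw [translation_mulVec_inl, Finset.sum_eq_zero, add_zero]
    intro l _
    by_cases hl : l = j
    · rw [hl, h, zero_mul]
    · rw [Pi.single_eq_of_ne (by simpa using hl), mul_zero]
  · rw [translation_mulVec_inr]

lemma fixesPair_inversion {s : Finset ι} {j : ι} (h : j ∉ s) : FixesPair (inversion s) j := by
  constructor <;> ext (i | i) <;>
    simp only [inversion_mulVec_inl, inversion_mulVec_inr, Pi.single_apply] <;> grind

/-- The elements of `H` fixing the basis vectors with index in `S`. -/
def fixingSubgroup (H : Subgroup (symplecticGroup ι ℤ)) (S : Set ι) :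
    Subgroup (symplecticGroup ι ℤ) where
  carrier := {h | h ∈ H ∧ ∀ j ∈ S, FixesPair h j}
  one_mem' := ⟨H.one_mem, fun j _ => fixesPair_one j⟩
  mul_mem' := fun ha hb => ⟨H.mul_mem ha.1 hb.1, fun j hj => (ha.2 j hj).mul (hb.2 j hj)⟩
  inv_mem' := fun ha => ⟨H.inv_mem ha.1, fun j hj => (ha.2 j hj).inv⟩

section Generation

variable {H : Subgroup (symplecticGroup ι ℤ)}

/-- A symplectic matrix fixing the basis vectors with index in `S` can be moved by an element of
`H` fixing the same vectors to one which fixes the basis vector `Sum.inl k` in addition. -/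
lemma exists_mul_mulVec_single_inl {S : Set ι}
    (hT : ∀ k l, translation (elemSymm k l 1) (elemSymm_isSymm k l 1) ∈ H)
    (hJ : ∀ k, inversion {k} ∈ H) {k : ι} (hk : k ∉ S)
    (γ : symplecticGroup ι ℤ) (hγ : ∀ j ∈ S, FixesPair γ j) :
    ∃ h ∈ fixingSubgroup H S, ((h * γ : symplecticGroup ι ℤ) : Matrix (ι ⊕ ι) (ι ⊕ ι) ℤ) *ᵥ
      Pi.single (Sum.inl k) 1 = Pi.single (Sum.inl k) 1 := by
  have hT' : ∀ k ∉ S, ∀ l ∉ S, ∀ q,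
      translation (elemSymm k l q) (elemSymm_isSymm k l q) ∈ fixingSubgroup H S := by
    refine fun k hk l hl q => ⟨translation_elemSymm_mem (hT k l) q, fun j hj => ?_⟩
    refine fixesPair_translation _ fun i => ?_
    simp only [elemSymm, of_apply]
    grind
  have hJ' : ∀ k ∉ S, inversion {k} ∈ fixingSubgroup H S := by
    refine fun k hk => ⟨hJ k, fun j hj => fixesPair_inversion ?_⟩
    grind
  obtain ⟨m, hm, h, hh, c, hc⟩ := exists_mulVec_eq_single_inl
    (v := (γ : Matrix (ι ⊕ ι) (ι ⊕ ι) ℤ) *ᵥ Pi.single (Sum.inl k) 1) hT' hJ'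
    (fun h hh w hw j hj => by
      have := (hh.2 j hj).mulVec_eq w
      rwa [(hw j hj).1, (hw j hj).2] at this)
    (fun j hj => by
      have := (hγ j hj).mulVec_eq (Pi.single (Sum.inl k) 1)
      rw [this.1, this.2]
      have : j ≠ k := fun h => hk (h ▸ hj)
      simp [this.symm])
    (fun h0 => by
      have := inv_mulVec_mulVec γ (Pi.single (Sum.inl k) 1)
      rw [h0, mulVec_zero] at this
      simpa using congr_fun this (Sum.inl k))
  obtain ⟨h₁, hh₁, c₁, hc₁⟩ := exists_mulVec_single_inl (hT' m hm k hk 1) (hJ' m hm) (hJ' k hk)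
  have hmul : ((h₁ * h * γ : symplecticGroup ι ℤ) : Matrix (ι ⊕ ι) (ι ⊕ ι) ℤ) *ᵥ
      Pi.single (Sum.inl k) 1 = (c * c₁) • Pi.single (Sum.inl k) 1 := by
    rw [mul_mulVec, mul_mulVec, hc, mulVec_smul, hc₁, smul_smul]
  have hunit : IsUnit (c * c₁) := by
    have h1 := inv_mulVec_mulVec (h₁ * h * γ) (Pi.single (Sum.inl k) 1)
    rw [hmul, mulVec_smul] at h1
    have h2 := congr_fun h1 (Sum.inl k)
    rw [Pi.smul_apply, Pi.single_eq_same, smul_eq_mul] at h2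
    exact IsUnit.of_mul_eq_one _ h2
  rcases Int.isUnit_iff.mp hunit with h1 | h1
  · exact ⟨h₁ * h, mul_mem hh₁ hh, by rw [hmul, h1, one_smul]⟩
  · refine ⟨inversion {k} * inversion {k} * (h₁ * h),
      mul_mem (mul_mem (hJ' k hk) (hJ' k hk)) (mul_mem hh₁ hh), ?_⟩
    rw [mul_assoc, mul_mulVec, hmul, h1, mulVec_smul, mul_mulVec]
    ext (i | i) <;> simp only [Pi.smul_apply, inversion_mulVec_inl, inversion_mulVec_inr,
      Pi.single_apply] <;> grind

lemma mem_of_fixesPair_of_notMem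
    (hT : ∀ k l, translation (elemSymm k l 1) (elemSymm_isSymm k l 1) ∈ H)
    (hJ : ∀ k, inversion {k} ∈ H) (s : Finset ι) :
    ∀ γ : symplecticGroup ι ℤ, (∀ j ∉ s, FixesPair γ j) → γ ∈ H := by
  induction s using Finset.induction_on with
  | empty =>
    intro γ hγ
    have : γ = 1 := ext_mulVec fun v => by
      ext (i | i)
      · simp [((hγ i (Finset.notMem_empty i)).mulVec_eq v).1]
      · simp [((hγ i (Finset.notMem_empty i)).mulVec_eq v).2]
    rw [this]
    exact H.one_mem
  | insert k s hks ih =>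
    intro γ hγ
    set S : Set ι := {j | j ∉ insert k s} with hS
    have hkS : k ∉ S := by simp [hS]
    obtain ⟨h, hh, hk⟩ := exists_mul_mulVec_single_inl hT hJ hkS γ hγ
    set δ := h * γ with hδ
    have hδS : ∀ j ∈ S, FixesPair δ j := fun j hj => (hh.2 j hj).mul (hγ j hj)
    set w := (δ : Matrix (ι ⊕ ι) (ι ⊕ ι) ℤ) *ᵥ Pi.single (Sum.inr k) 1 with hw
    have hwS : ∀ j ∈ S, w (Sum.inl j) = 0 ∧ w (Sum.inr j) = 0 := fun j hj => by
      have hjk : k ≠ j := fun e => hkS (e ▸ hj)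
      have := (hδS j hj).mulVec_eq (Pi.single (Sum.inr k) 1)
      rw [← hw] at this
      rw [this.1, this.2]
      simp [hjk]
    have hwk : w (Sum.inr k) = 1 := by
      rw [hw, mulVec_inr_of_mulVec_single_inl hk, Pi.single_eq_same]
    obtain ⟨B, hB, hBH, hBS, hB0⟩ := exists_translation_mulVec_inl_eq_zero hT hwk
    set w₁ := (translation B hB : Matrix (ι ⊕ ι) (ι ⊕ ι) ℤ) *ᵥ w with hw₁
    have hw₁r : ∀ i, w₁ (Sum.inr i) = w (Sum.inr i) := translation_mulVec_inr B hB w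
    set w₂ := (inversion s : Matrix (ι ⊕ ι) (ι ⊕ ι) ℤ) *ᵥ w₁ with hw₂
    have hw₂l : ∀ i, w₂ (Sum.inl i) = if i ∈ s then -w (Sum.inr i) else 0 := fun i => by
      rw [hw₂, inversion_mulVec_inl, hw₁r, hB0]
    have hw₂r : ∀ i, w₂ (Sum.inr i) = if i ∈ s then 0 else w (Sum.inr i) := fun i => by
      rw [hw₂, inversion_mulVec_inr, hw₁r, hB0]
    obtain ⟨B', hB', hBH', hBS', hB0'⟩ := exists_translation_mulVec_inl_eq_zero hT
      (v := w₂) (k := k) (by rw [hw₂r, if_neg hks, hwk])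
    have hfinal : ((inversion s)⁻¹ * translation B' hB' * inversion s * translation B hB * δ :
        symplecticGroup ι ℤ) ∈ H := by
      refine ih _ fun j hj => ?_
      by_cases hjk : j = k
      · subst hjk
        have hJk : FixesPair (inversion s) j := fixesPair_inversion hj
        constructor
        · simp only [mul_mulVec]
          rw [hk, translation_mulVec_single_inl, hJk.1, translation_mulVec_single_inl, hJk.inv.1]
        · simp only [mul_mulVec]
          rw [← hw, ← hw₁, ← hw₂]
          have : (translation B' hB' : Matrix (ι ⊕ ι) (ι ⊕ ι) ℤ) *ᵥ w₂ =
              Pi.single (Sum.inr j) 1 := by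
            ext (i | i)
            · rw [hB0', Pi.single_eq_of_ne (by simp)]
            · rw [translation_mulVec_inr, hw₂r]
              by_cases hij : i = j
              · subst hij
                rw [if_neg hj, hwk, Pi.single_eq_same]
              · rw [Pi.single_eq_of_ne (by simpa using hij)]
                by_cases his : i ∈ s
                · rw [if_pos his]
                · rw [if_neg his]
                  exact (hwS i (by simp [hS, hij, his])).2
          rw [this, hJk.inv.2]
      · have hjS : j ∈ S := by simp [hS, hjk, hj]
        have hJj : FixesPair (inversion s) j := fixesPair_inversion hj
        refine (((hJj.inv.mul (fixesPair_translation hB' (hBS' j hjk ?_))).mul hJj).mul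
          (fixesPair_translation hB (hBS j hjk (hwS j hjS).1))).mul (hδS j hjS)
        rw [hw₂l, if_neg hj]
    have hJs : inversion s ∈ H := inversion_mem s fun l _ => hJ l
    rw [H.mul_mem_cancel_left (H.mul_mem (H.mul_mem (H.mul_mem (H.inv_mem hJs) hBH') hJs) hBH),
      hδ, H.mul_mem_cancel_left hh.1] at hfinal
    exact hfinal

/-- The integral symplectic group is generated by the elementary translations and the inversions in
a single coordinate. -/
theorem eq_top_of_translation_mem_of_inversion_mem
    (hT : ∀ k l, translation (elemSymm k l 1) (elemSymm_isSymm k l 1) ∈ H)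
    (hJ : ∀ k, inversion {k} ∈ H) : H = ⊤ :=
  (Subgroup.eq_top_iff' H).mpr fun γ =>
    mem_of_fixesPair_of_notMem hT hJ Finset.univ γ fun j hj => absurd (Finset.mem_univ j) hj

end Generation

end SymplecticGroup

namespace Siegel

open Matrix ComplexConjugate

section Positivity

variable {ι : Type} [Fintype ι]

lemma im_star_dotProduct_mulVec {τ : Matrix ι ι ℂ} (hτ : τ.IsSymm) (w : ι → ℂ) :
    (star w ⬝ᵥ (τ *ᵥ w)).im =
      (∑ i, ∑ j, (w i).re * (τ i j).im * (w j).re) +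
        ∑ i, ∑ j, (w i).im * (τ i j).im * (w j).im := by
  have h1 : (star w ⬝ᵥ (τ *ᵥ w)).im = ∑ i, ∑ j, ((w i).re * (τ i j).im * (w j).re +
      (w i).im * (τ i j).im * (w j).im +
      ((w i).re * (τ i j).re * (w j).im - (w j).re * (τ j i).re * (w i).im)) := by
    simp only [dotProduct, mulVec, Finset.mul_sum, Complex.im_sum]
    refine Finset.sum_congr rfl fun i _ => Finset.sum_congr rfl fun j _ => ?_
    rw [hτ.apply i j]
    simp only [Pi.star_apply, Complex.star_def, Complex.mul_im, Complex.mul_re, Complex.conj_re,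
      Complex.conj_im]
    ring
  rw [h1]
  simp only [Finset.sum_add_distrib, Finset.sum_sub_distrib]
  rw [Finset.sum_comm (f := fun i j => (w j).re * (τ j i).re * (w i).im)]
  ring

lemma im_star_dotProduct_mulVec_pos {τ : Matrix ι ι ℂ} (hτ : τ ∈ Siegel ι) {w : ι → ℂ}
    (hw : w ≠ 0) : 0 < (star w ⬝ᵥ (τ *ᵥ w)).im := by
  rw [im_star_dotProduct_mulVec hτ.1]
  have hnonneg : ∀ v : ι → ℝ, 0 ≤ ∑ i, ∑ j, v i * (τ i j).im * v j := fun v => by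
    by_cases hv : v = 0
    · simp [hv]
    · exact (hτ.2 v hv).le
  by_cases hre : (fun i => (w i).re) = 0
  · have him : (fun i => (w i).im) ≠ 0 := fun him => hw <| funext fun i =>
      Complex.ext (congr_fun hre i) (congr_fun him i)
    exact add_pos_of_nonneg_of_pos (hnonneg _) (hτ.2 _ him)
  · exact add_pos_of_pos_of_nonneg (hτ.2 _ hre) (hnonneg _)

end Positivity

variable {g : ℕ} {A B C D : Matrix (Fin g) (Fin g) ℤ}

/-- The automorphy factor `Cτ + D`. -/
abbrev denom (C D : Matrix (Fin g) (Fin g) ℤ) (τ : Matrix (Fin g) (Fin g) ℂ) :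
    Matrix (Fin g) (Fin g) ℂ :=
  C.map (Int.cast : ℤ → ℂ) * τ + D.map (Int.cast : ℤ → ℂ)

lemma denom_mul_sub_mul_denom (h : fromBlocks A B C D ∈ symplecticGroup (Fin g) ℤ)
    (σ τ : Matrix (Fin g) (Fin g) ℂ) :
    (denom C D σᵀ)ᵀ * denom A B τ - (denom A B σᵀ)ᵀ * denom C D τ = τ - σ := by
  have h' := SymplecticGroup.map_mem h (Int.castRingHom ℂ)
  rw [fromBlocks_map, SymplecticGroup.fromBlocks_mem_iff] at h'
  obtain ⟨h1, h2, h3⟩ := h'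
  have h4 := congr_arg transpose h3
  simp only [transpose_sub, transpose_mul, transpose_transpose, transpose_one] at h4
  simp only [denom, transpose_add, transpose_mul, transpose_transpose]
  simp only [Int.coe_castRingHom] at h1 h2 h3 h4
  set a := A.map (Int.cast : ℤ → ℂ)
  set b := B.map (Int.cast : ℤ → ℂ)
  set c := C.map (Int.cast : ℤ → ℂ)
  set d := D.map (Int.cast : ℤ → ℂ)
  calc (σ * cᵀ + dᵀ) * (a * τ + b) - (σ * aᵀ + bᵀ) * (c * τ + d)
      = (dᵀ * a - bᵀ * c) * τ - σ * (aᵀ * d - cᵀ * b) - σ * (aᵀ * c - cᵀ * a) * τ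
          - (bᵀ * d - dᵀ * b) := by noncomm_ring
    _ = τ - σ := by rw [h1, h2, h3, h4]; simp

lemma transpose_denom_conjTranspose {τ : Matrix (Fin g) (Fin g) ℂ} (C D : Matrix (Fin g) (Fin g) ℤ) :
    (denom C D τᴴᵀ)ᵀ = (denom C D τ)ᴴ := by
  have hc : ∀ E : Matrix (Fin g) (Fin g) ℤ, (E.map (Int.cast : ℤ → ℂ))ᴴ =
      (E.map (Int.cast : ℤ → ℂ))ᵀ := fun E => by
    ext i j
    simp
  simp [denom, transpose_add, transpose_mul, conjTranspose_add, conjTranspose_mul, hc]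

lemma star_dotProduct_denom (h : fromBlocks A B C D ∈ symplecticGroup (Fin g) ℤ)
    {τ : Matrix (Fin g) (Fin g) ℂ} (w : Fin g → ℂ) :
    (star (denom C D τ *ᵥ w) ⬝ᵥ (denom A B τ *ᵥ w)).im = (star w ⬝ᵥ (τ *ᵥ w)).im := by
  have h1 := denom_mul_sub_mul_denom h τᴴ τ
  rw [transpose_denom_conjTranspose, transpose_denom_conjTranspose] at h1
  have h2 := congr_arg (fun M => star w ⬝ᵥ (M *ᵥ w)) h1
  simp only [sub_mulVec, dotProduct_sub, ← mulVec_mulVec] at h2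
  have key : ∀ (M : Matrix (Fin g) (Fin g) ℂ) (x y : Fin g → ℂ),
      star x ⬝ᵥ (Mᴴ *ᵥ y) = star (M *ᵥ x) ⬝ᵥ y := fun M x y => by
    rw [dotProduct_mulVec, star_mulVec]
  rw [key, key, key] at h2
  have hconj : ∀ x y : Fin g → ℂ, (star x ⬝ᵥ y).im = -(star y ⬝ᵥ x).im := fun x y => by
    rw [← star_star (star x ⬝ᵥ y), ← star_dotProduct_star, star_star, dotProduct_comm]
    simp
  have h3 := congr_arg Complex.im h2
  rw [Complex.sub_im, Complex.sub_im, hconj (denom A B τ *ᵥ w), hconj (τ *ᵥ w)] at h3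
  linarith

lemma isUnit_det_denom (h : fromBlocks A B C D ∈ symplecticGroup (Fin g) ℤ)
    {τ : Matrix (Fin g) (Fin g) ℂ} (hτ : τ ∈ Siegel (Fin g)) : IsUnit (denom C D τ).det := by
  rw [isUnit_iff_ne_zero]
  intro h0
  obtain ⟨w, hw, hw0⟩ := exists_mulVec_eq_zero_iff.mpr h0
  have := im_star_dotProduct_mulVec_pos hτ hw
  rw [← star_dotProduct_denom h, hw0] at this
  simp at this

lemma symplAction_mem (h : fromBlocks A B C D ∈ symplecticGroup (Fin g) ℤ)
    {τ : Matrix (Fin g) (Fin g) ℂ} (hτ : τ ∈ Siegel (Fin g)) :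
    symplAction A B C D τ ∈ Siegel (Fin g) := by
  have hu := isUnit_det_denom h hτ
  have hact : symplAction A B C D τ = denom A B τ * (denom C D τ)⁻¹ := rfl
  have hsymm : (symplAction A B C D τ).IsSymm := by
    have h1 := denom_mul_sub_mul_denom h τ τ
    rw [hτ.1.eq, sub_self, sub_eq_zero] at h1
    rw [hact, IsSymm, transpose_mul, transpose_nonsing_inv]
    have hu' : IsUnit (denom C D τ)ᵀ.det := by rwa [det_transpose]
    calc ((denom C D τ)ᵀ)⁻¹ * (denom A B τ)ᵀ
        = ((denom C D τ)ᵀ)⁻¹ * ((denom A B τ)ᵀ * denom C D τ) * (denom C D τ)⁻¹ := by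
          rw [Matrix.mul_assoc, Matrix.mul_assoc, mul_nonsing_inv _ hu, Matrix.mul_one]
      _ = denom A B τ * (denom C D τ)⁻¹ := by
          rw [← h1, ← Matrix.mul_assoc, nonsing_inv_mul _ hu', Matrix.one_mul]
  refine ⟨hsymm, fun v hv => ?_⟩
  set V : Fin g → ℂ := fun i => (v i : ℂ) with hV
  set w := (denom C D τ)⁻¹ *ᵥ V with hw
  have hNw : denom C D τ *ᵥ w = V := by
    rw [hw, mulVec_mulVec, mul_nonsing_inv _ hu, one_mulVec]
  have hw0 : w ≠ 0 := fun h0 => hv <| funext fun i => by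
    have := congr_fun hNw i
    rw [h0, mulVec_zero] at this
    simpa [hV] using this.symm
  have hpos := im_star_dotProduct_mulVec_pos hτ hw0
  rw [← star_dotProduct_denom h, hNw, hw, mulVec_mulVec, ← hact,
    im_star_dotProduct_mulVec hsymm] at hpos
  simpa [hV] using hpos

end Siegel

namespace Siegel

open Matrix

variable {g : ℕ}

/-- The action of a symplectic matrix on the Siegel upper half-space. -/
abbrev act (γ : symplecticGroup (Fin g) ℤ) (τ : Matrix (Fin g) (Fin g) ℂ) :
    Matrix (Fin g) (Fin g) ℂ :=
  symplAction γ.1.toBlocks₁₁ γ.1.toBlocks₁₂ γ.1.toBlocks₂₁ γ.1.toBlocks₂₂ τ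

/-- The automorphy factor `Cτ + D` of a symplectic matrix. -/
abbrev factor (γ : symplecticGroup (Fin g) ℤ) (τ : Matrix (Fin g) (Fin g) ℂ) :
    Matrix (Fin g) (Fin g) ℂ :=
  denom γ.1.toBlocks₂₁ γ.1.toBlocks₂₂ τ

lemma fromBlocks_toBlocks_mem (γ : symplecticGroup (Fin g) ℤ) :
    fromBlocks γ.1.toBlocks₁₁ γ.1.toBlocks₁₂ γ.1.toBlocks₂₁ γ.1.toBlocks₂₂ ∈
      symplecticGroup (Fin g) ℤ := by
  rw [fromBlocks_toBlocks]
  exact γ.2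

lemma act_mem (γ : symplecticGroup (Fin g) ℤ) {τ : Matrix (Fin g) (Fin g) ℂ}
    (hτ : τ ∈ Siegel (Fin g)) : act γ τ ∈ Siegel (Fin g) :=
  symplAction_mem (fromBlocks_toBlocks_mem γ) hτ

lemma isUnit_det_factor (γ : symplecticGroup (Fin g) ℤ) {τ : Matrix (Fin g) (Fin g) ℂ}
    (hτ : τ ∈ Siegel (Fin g)) : IsUnit (factor γ τ).det :=
  isUnit_det_denom (fromBlocks_toBlocks_mem γ) hτ

lemma toBlocks_mul (M N : Matrix (Fin g ⊕ Fin g) (Fin g ⊕ Fin g) ℤ) :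
    (M * N).toBlocks₁₁ = M.toBlocks₁₁ * N.toBlocks₁₁ + M.toBlocks₁₂ * N.toBlocks₂₁ ∧
    (M * N).toBlocks₁₂ = M.toBlocks₁₁ * N.toBlocks₁₂ + M.toBlocks₁₂ * N.toBlocks₂₂ ∧
    (M * N).toBlocks₂₁ = M.toBlocks₂₁ * N.toBlocks₁₁ + M.toBlocks₂₂ * N.toBlocks₂₁ ∧
    (M * N).toBlocks₂₂ = M.toBlocks₂₁ * N.toBlocks₁₂ + M.toBlocks₂₂ * N.toBlocks₂₂ := by
  have h := fromBlocks_multiply M.toBlocks₁₁ M.toBlocks₁₂ M.toBlocks₂₁ M.toBlocks₂₂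
    N.toBlocks₁₁ N.toBlocks₁₂ N.toBlocks₂₁ N.toBlocks₂₂
  rw [fromBlocks_toBlocks, fromBlocks_toBlocks] at h
  rw [h]
  simp

lemma denom_comp {τ : Matrix (Fin g) (Fin g) ℂ} {A B C D : Matrix (Fin g) (Fin g) ℤ}
    (hu : IsUnit (denom C D τ).det) (E F : Matrix (Fin g) (Fin g) ℤ) :
    denom (E * A + F * C) (E * B + F * D) τ =
      denom E F (symplAction A B C D τ) * denom C D τ := by
  have hmap : ∀ X Y : Matrix (Fin g) (Fin g) ℤ, (X * Y).map (Int.cast : ℤ → ℂ) =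
      X.map (Int.cast : ℤ → ℂ) * Y.map (Int.cast : ℤ → ℂ) := fun X Y =>
    Matrix.map_mul (f := Int.castRingHom ℂ)
  have hadd : ∀ X Y : Matrix (Fin g) (Fin g) ℤ, (X + Y).map (Int.cast : ℤ → ℂ) =
      X.map (Int.cast : ℤ → ℂ) + Y.map (Int.cast : ℤ → ℂ) := fun X Y =>
    Matrix.map_add _ Int.cast_add X Y
  have hact : symplAction A B C D τ * denom C D τ = denom A B τ := by
    rw [symplAction, Matrix.mul_assoc, nonsing_inv_mul _ hu, Matrix.mul_one]
  rw [denom, denom, Matrix.add_mul, Matrix.mul_assoc, hact, hadd, hadd, hmap, hmap, hmap, hmap]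
  simp only [denom]
  noncomm_ring

lemma factor_mul (γ δ : symplecticGroup (Fin g) ℤ) {τ : Matrix (Fin g) (Fin g) ℂ}
    (hτ : τ ∈ Siegel (Fin g)) : factor (γ * δ) τ = factor γ (act δ τ) * factor δ τ := by
  obtain ⟨-, -, h3, h4⟩ := toBlocks_mul γ.1 δ.1
  rw [factor, Submonoid.coe_mul, h3, h4]
  exact denom_comp (isUnit_det_factor δ hτ) _ _

lemma act_mul (γ δ : symplecticGroup (Fin g) ℤ) {τ : Matrix (Fin g) (Fin g) ℂ}
    (hτ : τ ∈ Siegel (Fin g)) : act (γ * δ) τ = act γ (act δ τ) := by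
  obtain ⟨h1, h2, -, -⟩ := toBlocks_mul γ.1 δ.1
  have hu := isUnit_det_factor δ hτ
  have hnum : denom (γ * δ).1.toBlocks₁₁ (γ * δ).1.toBlocks₁₂ τ =
      denom γ.1.toBlocks₁₁ γ.1.toBlocks₁₂ (act δ τ) * factor δ τ := by
    rw [Submonoid.coe_mul, h1, h2]
    exact denom_comp hu _ _
  change denom (γ * δ).1.toBlocks₁₁ (γ * δ).1.toBlocks₁₂ τ * (factor (γ * δ) τ)⁻¹ =
    denom γ.1.toBlocks₁₁ γ.1.toBlocks₁₂ (act δ τ) * (factor γ (act δ τ))⁻¹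
  rw [hnum, factor_mul γ δ hτ, Matrix.mul_inv_rev, Matrix.mul_assoc, ← Matrix.mul_assoc (factor δ τ),
    mul_nonsing_inv _ hu, Matrix.one_mul]

lemma factor_one (τ : Matrix (Fin g) (Fin g) ℂ) : factor 1 τ = 1 := by
  rw [factor, Submonoid.coe_one, ← fromBlocks_one, toBlocks_fromBlocks₂₁, toBlocks_fromBlocks₂₂]
  simp [denom]

lemma act_one (τ : Matrix (Fin g) (Fin g) ℂ) : act 1 τ = τ := by
  rw [act, Submonoid.coe_one, ← fromBlocks_one, toBlocks_fromBlocks₁₁, toBlocks_fromBlocks₁₂,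
    toBlocks_fromBlocks₂₁, toBlocks_fromBlocks₂₂]
  simp [symplAction]

/-- The symplectic matrices under which `F` transforms as a modular form of weight `k`. -/
def modularSubgroup (F : Matrix (Fin g) (Fin g) ℂ → ℂ) (k : ℕ) :
    Subgroup (symplecticGroup (Fin g) ℤ) where
  carrier := {γ | ∀ τ ∈ Siegel (Fin g), F (act γ τ) = (factor γ τ).det ^ k * F τ}
  one_mem' := fun τ _ => by rw [act_one, factor_one, det_one, one_pow, one_mul]
  mul_mem' := fun {γ δ} hγ hδ τ hτ => by
    rw [act_mul γ δ hτ, hγ _ (act_mem δ hτ), hδ τ hτ, factor_mul γ δ hτ, det_mul, mul_pow, mul_assoc]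
  inv_mem' := fun {γ} hγ τ hτ => by
    have h1 := hγ _ (act_mem γ⁻¹ hτ)
    have h2 := factor_mul γ γ⁻¹ hτ
    rw [← act_mul γ γ⁻¹ hτ, mul_inv_cancel, act_one] at h1
    rw [mul_inv_cancel, factor_one] at h2
    have h3 : (factor γ (act γ⁻¹ τ)).det * (factor γ⁻¹ τ).det = 1 := by
      rw [← det_mul, ← h2, det_one]
    rw [h1, ← mul_assoc, ← mul_pow, mul_comm (factor γ⁻¹ τ).det, h3, one_pow, one_mul]

end Siegel

namespace IsAffineCosetDim

variable {ι : Type} [Fintype ι]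

lemma card_eq {i : ℕ} {W : Finset (Char2 ι)} (h : IsAffineCosetDim i W) : W.card = 2 ^ i := by
  obtain ⟨V, x, hV, hW⟩ := h
  rw [← Set.ncard_coe_finset, hW, Set.ncard_image_of_injective _ (add_right_injective x), ← hV]
  have := Module.natCard_eq_pow_finrank (K := ZMod 2) (V := V)
  rwa [Nat.card_zmod] at this

/-- The fibre of a linear form on an affine subspace is empty or loses at most one dimension. -/
lemma filter_eq_empty_or {i : ℕ} {W : Finset (Char2 ι)} (h : IsAffineCosetDim i W)
    (φ : Char2 ι →ₗ[ZMod 2] ZMod 2) (a : ZMod 2) :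
    W.filter (fun w => φ w = a) = ∅ ∨
      ∃ j, i - 1 ≤ j ∧ IsAffineCosetDim j (W.filter fun w => φ w = a) := by
  obtain ⟨V, x, hV, hW⟩ := h
  have hmem : ∀ w, w ∈ W ↔ ∃ v ∈ V, x + v = w := fun w => by
    rw [← Finset.mem_coe, hW]
    rfl
  rcases Finset.eq_empty_or_nonempty (W.filter fun w => φ w = a) with h0 | ⟨y, hy⟩
  · exact Or.inl h0
  refine Or.inr ⟨_, ?_, V ⊓ LinearMap.ker φ, y, rfl, ?_⟩
  · have h1 := Submodule.finrank_sup_add_finrank_inf_eq V (LinearMap.ker φ)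
    have h2 := LinearMap.finrank_range_add_finrank_ker φ
    have h3 := Submodule.finrank_le (LinearMap.range φ)
    have h4 := Submodule.finrank_le (V ⊔ LinearMap.ker φ)
    rw [Module.finrank_self] at h3
    omega
  · rw [Finset.mem_filter, hmem] at hy
    obtain ⟨⟨v, hv, rfl⟩, hya⟩ := hy
    ext w
    simp only [Finset.coe_filter, hmem, Set.mem_ofPred_eq, Set.mem_image, SetLike.mem_coe,
      Submodule.mem_inf, LinearMap.mem_ker]
    constructor
    · rintro ⟨⟨u, hu, rfl⟩, hwa⟩
      refine ⟨u - v, ⟨V.sub_mem hu hv, ?_⟩, by abel⟩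
      rw [map_add] at hya hwa
      rw [map_sub, sub_eq_zero]
      exact add_left_cancel (hwa.trans hya.symm)
    · rintro ⟨u, ⟨hu, hφ⟩, rfl⟩
      exact ⟨⟨v + u, V.add_mem hv hu, by abel⟩, by rw [map_add, hφ, add_zero, hya]⟩

lemma map_affine {i : ℕ} {W : Finset (Char2 ι)} (h : IsAffineCosetDim i W)
    (σ : Char2 ι ≃ Char2 ι) (L : Char2 ι →ₗ[ZMod 2] Char2 ι) (b : Char2 ι)
    (hσ : ∀ m, σ m = L m + b) : IsAffineCosetDim i (W.map σ.toEmbedding) := by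
  obtain ⟨V, x, hV, hW⟩ := h
  have hL : Function.Injective L := fun m n hmn => σ.injective (by rw [hσ, hσ, hmn])
  refine ⟨V.map L, σ x, ?_, ?_⟩
  · rw [← hV]
    exact (LinearEquiv.finrank_eq (Submodule.equivMapOfInjective L hL V)).symm
  · rw [Finset.coe_map, hW, Submodule.map_coe, Set.image_image, Set.image_image]
    refine Set.image_congr fun v _ => ?_
    simp only [Equiv.coe_toEmbedding, hσ, map_add]
    abel

end IsAffineCosetDim

/-- A set of characteristics which is empty or an affine subspace of dimension at least `n`. -/
def IsEmptyOrAffine {ι : Type} [Fintype ι] (n : ℕ) (W : Finset (Char2 ι)) : Prop :=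
  W = ∅ ∨ ∃ j, n ≤ j ∧ IsAffineCosetDim j W

namespace IsEmptyOrAffine

variable {ι : Type} [Fintype ι]

lemma two_pow_dvd_card {n : ℕ} {W : Finset (Char2 ι)} (h : IsEmptyOrAffine n W) :
    2 ^ n ∣ W.card := by
  rcases h with rfl | ⟨j, hj, h⟩
  · simp
  · rw [h.card_eq]
    exact pow_dvd_pow 2 hj

lemma filter {n : ℕ} {W : Finset (Char2 ι)} (h : IsEmptyOrAffine n W)
    (φ : Char2 ι →ₗ[ZMod 2] ZMod 2) (a : ZMod 2) :
    IsEmptyOrAffine (n - 1) (W.filter fun w => φ w = a) := by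
  rcases h with rfl | ⟨j, hj, h⟩
  · exact Or.inl (Finset.filter_empty _)
  · rcases h.filter_eq_empty_or φ a with h0 | ⟨l, hl, h⟩
    · exact Or.inl h0
    · exact Or.inr ⟨l, by omega, h⟩

/-- Roots of unity supported on an intersection of `r` affine hyperplanes cancel. -/
lemma prod_ite_pow_eq_one {i r : ℕ} (hi : i ≤ 4) {W : Finset (Char2 ι)} {p : Char2 ι → Prop}
    [DecidablePred p] (h : IsEmptyOrAffine (i - r) (W.filter p)) {ζ : ℂ}
    (hζ : ζ ^ 2 ^ (4 - r) = 1) :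
    (∏ w ∈ W, if p w then ζ else 1) ^ 2 ^ (4 - i) = 1 := by
  rw [← Finset.prod_filter, Finset.prod_const, ← pow_mul]
  obtain ⟨q, hq⟩ : 2 ^ (4 - r) ∣ (W.filter p).card * 2 ^ (4 - i) := by
    refine dvd_trans ?_ (Nat.mul_dvd_mul_right h.two_pow_dvd_card _)
    rw [← pow_add]
    exact pow_dvd_pow 2 (by omega)
  rw [hq, pow_mul, hζ, one_pow]

end IsEmptyOrAffine

section Coordinates

variable {ι : Type}

/-- The coordinate `ε k` of a characteristic as a linear form. -/
def epsCoord (k : ι) : Char2 ι →ₗ[ZMod 2] ZMod 2 :=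
  LinearMap.proj k ∘ₗ LinearMap.fst (ZMod 2) (ι → ZMod 2) (ι → ZMod 2)

/-- The coordinate `δ k` of a characteristic as a linear form. -/
def delCoord (k : ι) : Char2 ι →ₗ[ZMod 2] ZMod 2 :=
  LinearMap.proj k ∘ₗ LinearMap.snd (ZMod 2) (ι → ZMod 2) (ι → ZMod 2)

lemma epsCoord_apply (k : ι) (m : Char2 ι) : epsCoord k m = m.1 k := rfl

end Coordinates

lemma Sform_eq_mul_of_thetaConst {ι : Type} [Fintype ι] {i s : ℕ} {τ τ' : Matrix ι ι ℂ}
    {K : ℂ} {c : Char2 ι → ℂ} {σ : Char2 ι → Char2 ι} (hinv : Function.Involutive σ)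
    (L : Char2 ι →ₗ[ZMod 2] Char2 ι) (b : Char2 ι) (hσ : ∀ m, σ m = L m + b)
    (hθ : ∀ m, thetaConst m τ' = K * c m * thetaConst (σ m) τ)
    (hc : ∀ W, IsAffineCosetDim i W → (∏ w ∈ W, c w) ^ s = 1) :
    Sform ι i s τ' = K ^ (2 ^ i * s) * Sform ι i s τ := by
  classical
  unfold Sform
  rw [Finset.mul_sum]
  set e := hinv.toPerm
  have hmapmap : ∀ W : Finset (Char2 ι), (W.map e.toEmbedding).map e.toEmbedding = W := fun W => by
    rw [Finset.map_map]
    convert Finset.map_refl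
    ext1 m
    exact hinv m
  refine Finset.sum_bij' (fun W _ => W.map e.toEmbedding) (fun W _ => W.map e.toEmbedding)
    ?_ ?_ (fun W _ => hmapmap W) (fun W _ => hmapmap W) ?_
  · intro W hW
    rw [Finset.mem_filter] at hW ⊢
    exact ⟨Finset.mem_univ _, hW.2.map_affine e L b hσ⟩
  · intro W hW
    rw [Finset.mem_filter] at hW ⊢
    exact ⟨Finset.mem_univ _, hW.2.map_affine e L b hσ⟩
  · intro W hW
    rw [Finset.mem_filter] at hW
    simp only [hθ, Finset.prod_mul_distrib, Finset.prod_const, hW.2.card_eq, mul_pow, hc W hW.2,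
      mul_one, Finset.prod_map, pow_mul]
    rfl

section Translations

variable {ι : Type} [Fintype ι]

/-- The `n`-th term of the series defining the theta constant with characteristic `m`. -/
def thetaTerm (m : Char2 ι) (τ : Matrix ι ι ℂ) (n : ι → ℤ) : ℂ :=
  Complex.exp (Real.pi * Complex.I *
    ((∑ i, ∑ j, ((n i : ℂ) + ((m.1 i).val : ℂ) / 2) * τ i j * ((n j : ℂ) + ((m.1 j).val : ℂ) / 2)) +
      ∑ i, ((n i : ℂ) + ((m.1 i).val : ℂ) / 2) * ((m.2 i).val : ℂ)))

lemma thetaConst_eq_tsum (m : Char2 ι) (τ : Matrix ι ι ℂ) :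
    thetaConst m τ = ∑' n, thetaTerm m τ n := by
  simp only [thetaConst, thetaChar, theta, thetaTerm, Finset.mul_sum]
  refine tsum_congr fun n => ?_
  congr 3
  refine Finset.sum_congr rfl fun i _ => ?_
  simp only [Pi.zero_apply]
  ring

lemma exp_pi_mul_I_eq {x y : ℂ} (q : ℤ) (h : x = y + 2 * q) :
    Complex.exp (Real.pi * Complex.I * x) = Complex.exp (Real.pi * Complex.I * y) := by
  rw [h, Complex.exp_eq_exp_iff_exists_int]
  exact ⟨q, by ring⟩

variable [DecidableEq ι]

lemma sum_mul_val_add_single (r : ι → ℂ) (δ : ι → ZMod 2) (k : ι) (a : ZMod 2) :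
    ∑ i, r i * (((δ + Pi.single k a : ι → ZMod 2) i).val : ℂ) =
      (∑ i, r i * ((δ i).val : ℂ)) + r k * (((δ k + a).val : ℂ) - ((δ k).val : ℂ)) := by
  rw [← sub_eq_iff_eq_add', ← Finset.sum_sub_distrib, Finset.sum_eq_single k]
  · simp [mul_sub]
  · intro j _ hj
    simp [hj]
  · simp

lemma sum_sum_mul_add_elemSymm_self (r : ι → ℂ) (τ : Matrix ι ι ℂ) (k : ι) :
    ∑ i, ∑ j, r i * (τ + (SymplecticGroup.elemSymm k k 1).map (Int.cast : ℤ → ℂ)) i j * r j =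
      (∑ i, ∑ j, r i * τ i j * r j) + r k * r k := by
  simp only [Matrix.add_apply, Matrix.map_apply, mul_add, add_mul, Finset.sum_add_distrib,
    add_right_inj]
  rw [Finset.sum_eq_single k, Finset.sum_eq_single k]
  · simp [SymplecticGroup.elemSymm]
  · intro j _ hj
    simp [SymplecticGroup.elemSymm, hj]
  · simp
  · intro j _ hj
    simp [SymplecticGroup.elemSymm, hj]
  · simp

lemma sum_sum_mul_add_elemSymm (r : ι → ℂ) (τ : Matrix ι ι ℂ) {k l : ι} (hkl : k ≠ l) :
    ∑ i, ∑ j, r i * (τ + (SymplecticGroup.elemSymm k l 1).map (Int.cast : ℤ → ℂ)) i j * r j =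
      (∑ i, ∑ j, r i * τ i j * r j) + 2 * (r k * r l) := by
  have h : ∀ i j, r i * ((SymplecticGroup.elemSymm k l 1).map (Int.cast : ℤ → ℂ)) i j * r j =
      (if i = k then (if j = l then r i * r j else 0) else 0) +
        (if i = l then (if j = k then r i * r j else 0) else 0) := fun i j => by
    simp only [SymplecticGroup.elemSymm, Matrix.map_apply, Matrix.of_apply]
    by_cases h1 : i = k <;> by_cases h2 : i = l <;> by_cases h3 : j = l <;> by_cases h4 : j = k <;>
      simp_all
  simp only [Matrix.add_apply, mul_add, add_mul, Finset.sum_add_distrib, h]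
  simp only [← ite_and, add_right_inj]
  have : ∀ a b : ι, ∑ i, ∑ j, (if i = a ∧ j = b then r i * r j else 0) = r a * r b := fun a b => by
    simp [ite_and]
  rw [this, this]
  ring

lemma zmod_two_eq_zero_or_one : ∀ e : ZMod 2, e = 0 ∨ e = 1 := by decide

lemma cast_val_add_one (d : ZMod 2) : ((d + 1).val : ℂ) = 1 - (d.val : ℂ) := by
  have h11 : (1 : ZMod 2) + 1 = 0 := rfl
  rcases zmod_two_eq_zero_or_one d with rfl | rfl
  · rw [zero_add, ZMod.val_one, ZMod.val_zero]
    simp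
  · rw [h11, ZMod.val_one, ZMod.val_zero]
    simp

lemma thetaConst_add_elemSymm_self (m : Char2 ι) (τ : Matrix ι ι ℂ) (k : ι) :
    thetaConst m (τ + (SymplecticGroup.elemSymm k k 1).map (Int.cast : ℤ → ℂ)) =
      (if m.1 k = 1 then Complex.exp (Real.pi * Complex.I * (1 / 4)) else 1) *
        thetaConst (m.1, m.2 + Pi.single k (m.1 k + 1)) τ := by
  rw [thetaConst_eq_tsum, thetaConst_eq_tsum, ← tsum_mul_left]
  refine tsum_congr fun n => ?_
  simp only [thetaTerm]
  rw [sum_mul_val_add_single (fun i => (n i : ℂ) + ((m.1 i).val : ℂ) / 2) m.2,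
    sum_sum_mul_add_elemSymm_self (fun i => (n i : ℂ) + ((m.1 i).val : ℂ) / 2)]
  generalize ∑ i, ∑ j, ((n i : ℂ) + ((m.1 i).val : ℂ) / 2) * τ i j *
    ((n j : ℂ) + ((m.1 j).val : ℂ) / 2) = Q
  generalize ∑ i, ((n i : ℂ) + ((m.1 i).val : ℂ) / 2) * ((m.2 i).val : ℂ) = R
  generalize n k = n
  generalize m.1 k = e
  generalize m.2 k = d
  rcases zmod_two_eq_zero_or_one e with rfl | rfl
  · obtain ⟨q, hq⟩ := Int.even_mul_pred_self n
    have hq' := congr_arg (Int.cast : ℤ → ℂ) hq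
    push_cast at hq'
    simp only [zero_ne_one, if_false, one_mul, ZMod.val_zero, zero_add, Nat.cast_zero,
      zero_div, add_zero, cast_val_add_one]
    refine exp_pi_mul_I_eq (q + n * d.val) ?_
    push_cast
    linear_combination hq'
  · obtain ⟨q, hq⟩ := Int.even_mul_succ_self n
    have hq' := congr_arg (Int.cast : ℤ → ℂ) hq
    push_cast at hq'
    have h11 : (1 : ZMod 2) + 1 = 0 := rfl
    simp only [if_true, ZMod.val_one, Nat.cast_one, h11, add_zero, sub_self, mul_zero]
    rw [← Complex.exp_add, ← mul_add]
    refine exp_pi_mul_I_eq q ?_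
    linear_combination hq'

lemma thetaConst_add_elemSymm (m : Char2 ι) (τ : Matrix ι ι ℂ) {k l : ι} (hkl : k ≠ l) :
    thetaConst m (τ + (SymplecticGroup.elemSymm k l 1).map (Int.cast : ℤ → ℂ)) =
      ((if m.1 k = 1 ∧ m.1 l = 1 then -Complex.I else 1) *
        (if (m.1 k = 1 ∧ m.1 l = 1) ∧ m.2 k + m.2 l = 1 then -1 else 1)) *
        thetaConst (m.1, m.2 + Pi.single k (m.1 l) + Pi.single l (m.1 k)) τ := by
  have hI : -Complex.I = Complex.exp (Real.pi * Complex.I * (-1 / 2)) := by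
    rw [show Real.pi * Complex.I * (-1 / 2) = -(Real.pi / 2 * Complex.I) by ring, Complex.exp_neg,
      Complex.exp_pi_div_two_mul_I, Complex.inv_I]
  rw [thetaConst_eq_tsum, thetaConst_eq_tsum, ← tsum_mul_left]
  refine tsum_congr fun n => ?_
  simp only [thetaTerm]
  rw [sum_mul_val_add_single (fun i => (n i : ℂ) + ((m.1 i).val : ℂ) / 2),
    sum_mul_val_add_single (fun i => (n i : ℂ) + ((m.1 i).val : ℂ) / 2) m.2,
    sum_sum_mul_add_elemSymm (fun i => (n i : ℂ) + ((m.1 i).val : ℂ) / 2) τ hkl,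
    Pi.add_apply, Pi.single_eq_of_ne hkl.symm, add_zero]
  generalize ∑ i, ∑ j, ((n i : ℂ) + ((m.1 i).val : ℂ) / 2) * τ i j *
    ((n j : ℂ) + ((m.1 j).val : ℂ) / 2) = Q
  generalize ∑ i, ((n i : ℂ) + ((m.1 i).val : ℂ) / 2) * ((m.2 i).val : ℂ) = R
  generalize n k = a
  generalize n l = b
  have h11 : (1 : ZMod 2) + 1 = 0 := rfl
  rcases zmod_two_eq_zero_or_one (m.1 k) with h1 | h1 <;> rcases zmod_two_eq_zero_or_one (m.1 l) with h2 | h2 <;>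
    simp only [h1, h2, zero_ne_one, if_false, if_true, ZMod.val_one, ZMod.val_zero,
      add_zero, one_mul, Nat.cast_one, Nat.cast_zero, and_false,
      true_and, false_and, and_self, cast_val_add_one]
  · exact exp_pi_mul_I_eq (a * b) (by push_cast; ring)
  · exact exp_pi_mul_I_eq (a * b + a * (m.2 k).val) (by push_cast; ring)
  · exact exp_pi_mul_I_eq (a * b + b * (m.2 l).val) (by push_cast; ring)
  · have h : Complex.exp (Real.pi * Complex.I * (((m.2 k).val : ℂ) + (m.2 l).val)) =
        if m.2 k + m.2 l = 1 then -1 else 1 := by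
      rcases zmod_two_eq_zero_or_one (m.2 k) with h3 | h3 <;> rcases zmod_two_eq_zero_or_one (m.2 l) with h4 | h4 <;>
        simp [h3, h4, h11, ZMod.val_one]
      rw [show Real.pi * Complex.I * (1 + 1) = 2 * Real.pi * Complex.I by ring, Complex.exp_two_pi_mul_I]
    rw [hI, ← h, ← Complex.exp_add, ← mul_add, ← Complex.exp_add, ← mul_add]
    exact exp_pi_mul_I_eq (a * b + a * (m.2 k).val + b * (m.2 l).val) (by push_cast; ring)

end Translations

section SformTranslations

variable {ι : Type}

lemma pi_zmod_two_add_self (x : ι → ZMod 2) : x + x = 0 :=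
  funext fun _ => CharTwo.add_self_eq_zero _

lemma IsAffineCosetDim.isEmptyOrAffine [Fintype ι] {i : ℕ} {W : Finset (Char2 ι)} (h : IsAffineCosetDim i W) :
    IsEmptyOrAffine i W :=
  Or.inr ⟨i, le_rfl, h⟩

variable [DecidableEq ι]

/-- The linear map adding the value of the form `φ` to the coordinate `δ k`. -/
def shearDel (φ : Char2 ι →ₗ[ZMod 2] ZMod 2) (k : ι) : Char2 ι →ₗ[ZMod 2] Char2 ι :=
  LinearMap.inr (ZMod 2) (ι → ZMod 2) (ι → ZMod 2) ∘ₗ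
    LinearMap.single (ZMod 2) (fun _ => ZMod 2) k ∘ₗ φ

lemma shearDel_apply (φ : Char2 ι →ₗ[ZMod 2] ZMod 2) (k : ι) (m : Char2 ι) :
    shearDel φ k m = (0, Pi.single k (φ m)) := rfl

variable [Fintype ι]

lemma Sform_add_elemSymm_self {i : ℕ} (hi : i ≤ 4) (τ : Matrix ι ι ℂ) (k : ι) :
    Sform ι i (2 ^ (4 - i)) (τ + (SymplecticGroup.elemSymm k k 1).map (Int.cast : ℤ → ℂ)) =
      Sform ι i (2 ^ (4 - i)) τ := by
  have key := Sform_eq_mul_of_thetaConst (i := i) (s := 2 ^ (4 - i)) (K := 1)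
    (σ := fun m : Char2 ι => (m.1, m.2 + Pi.single k (m.1 k + 1)))
    (fun m => Prod.ext rfl ?_)
    (LinearMap.id + shearDel (epsCoord k) k) (0, Pi.single k 1) (fun m => ?_)
    (fun m => (thetaConst_add_elemSymm_self m τ k).trans (by rw [one_mul])) (fun W hW => ?_)
  · rw [key, one_pow, one_mul]
  · change m.2 + Pi.single k (m.1 k + 1) + Pi.single k (m.1 k + 1) = m.2
    rw [add_assoc, pi_zmod_two_add_self, add_zero]
  · ext j <;> simp [shearDel_apply, epsCoord_apply, add_assoc, Pi.single_add]
  · refine IsEmptyOrAffine.prod_ite_pow_eq_one (r := 1) hi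
      (hW.isEmptyOrAffine.filter (epsCoord k) 1) ?_
    rw [← Complex.exp_nat_mul, show ((2 ^ (4 - 1) : ℕ) : ℂ) * (Real.pi * Complex.I * (1 / 4)) =
      2 * Real.pi * Complex.I by push_cast; ring, Complex.exp_two_pi_mul_I]

lemma Sform_add_elemSymm {i : ℕ} (hi : i ≤ 4) (τ : Matrix ι ι ℂ) {k l : ι} (hkl : k ≠ l) :
    Sform ι i (2 ^ (4 - i)) (τ + (SymplecticGroup.elemSymm k l 1).map (Int.cast : ℤ → ℂ)) =
      Sform ι i (2 ^ (4 - i)) τ := by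
  have key := Sform_eq_mul_of_thetaConst (i := i) (s := 2 ^ (4 - i)) (K := 1)
    (σ := fun m : Char2 ι => (m.1, m.2 + Pi.single k (m.1 l) + Pi.single l (m.1 k)))
    (fun m => Prod.ext rfl ?_)
    (LinearMap.id + shearDel (epsCoord l) k + shearDel (epsCoord k) l) 0 (fun m => ?_)
    (fun m => (thetaConst_add_elemSymm m τ hkl).trans (by rw [one_mul])) (fun W hW => ?_)
  · rw [key, one_pow, one_mul]
  · change m.2 + Pi.single k (m.1 l) + Pi.single l (m.1 k) + Pi.single k (m.1 l) +
      Pi.single l (m.1 k) = m.2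
    rw [add_right_comm _ (Pi.single l (m.1 k) : ι → ZMod 2), add_assoc, pi_zmod_two_add_self,
      add_zero, add_assoc, pi_zmod_two_add_self, add_zero]
  · ext j <;> simp [shearDel_apply, epsCoord_apply]
  · have h2 : IsEmptyOrAffine (i - 2) (W.filter fun w => w.1 k = 1 ∧ w.1 l = 1) := by
      rw [← Finset.filter_filter]
      exact (hW.isEmptyOrAffine.filter (epsCoord k) 1).filter (epsCoord l) 1
    have h3 : IsEmptyOrAffine (i - 3)
        (W.filter fun w => (w.1 k = 1 ∧ w.1 l = 1) ∧ w.2 k + w.2 l = 1) := by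
      rw [← Finset.filter_filter]
      exact h2.filter (delCoord k + delCoord l) 1
    rw [Finset.prod_mul_distrib, mul_pow, IsEmptyOrAffine.prod_ite_pow_eq_one (r := 2) hi h2,
      IsEmptyOrAffine.prod_ite_pow_eq_one (r := 3) hi h3, one_mul]
    · norm_num
    · norm_num [pow_succ]

end SformTranslations

section Summability

variable {ι : Type} [Fintype ι]

lemma summable_prod_pi {β : Type*} [DecidableEq β] [DecidableEq ι] {f : ι → β → ℝ}
    (hf : ∀ i b, 0 ≤ f i b) (hs : ∀ i, Summable (f i)) :
    Summable fun n : ι → β => ∏ i, f i (n i) := by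
  refine summable_of_sum_le (c := ∏ i, ∑' b, f i b)
    (fun n => Finset.prod_nonneg fun i _ => hf i _) fun s => ?_
  calc ∑ n ∈ s, ∏ i, f i (n i)
      ≤ ∑ n ∈ Fintype.piFinset fun i => s.image fun n => n i, ∏ i, f i (n i) :=
        Finset.sum_le_sum_of_subset_of_nonneg
          (fun n hn => Fintype.mem_piFinset.mpr fun i => Finset.mem_image_of_mem _ hn)
          fun n _ _ => Finset.prod_nonneg fun i _ => hf i _
    _ = ∏ i, ∑ b ∈ s.image fun n => n i, f i b := Finset.prod_univ_sum _ _ |>.symm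
    _ ≤ ∏ i, ∑' b, f i b := Finset.prod_le_prod (fun i _ => Finset.sum_nonneg fun b _ => hf i b)
        fun i _ => (hs i).sum_le_tsum _ fun b _ => hf i b

lemma summable_exp_neg_mul_add_sq {c : ℝ} (hc : 0 < c) (x : ℝ) :
    Summable fun n : ℤ => Real.exp (-Real.pi * c * ((n : ℝ) + x) ^ 2) := by
  have h := ((summable_jacobiTheta₂_term_iff (Complex.I * (c * x)) (Complex.I * c)).mpr
    (by simpa using hc)).norm.mul_left (Real.exp (-Real.pi * c * x ^ 2))
  refine h.congr fun n => ?_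
  rw [jacobiTheta₂_term, Complex.norm_exp, ← Real.exp_add]
  congr 1
  have : 2 * (Real.pi : ℂ) * Complex.I * n * (Complex.I * (c * x)) +
      Real.pi * Complex.I * (n : ℂ) ^ 2 * (Complex.I * c) =
      ((-Real.pi * c * (2 * n * x + n ^ 2) : ℝ) : ℂ) := by
    push_cast
    linear_combination (2 * Real.pi * n * c * x + Real.pi * n ^ 2 * c : ℂ) * Complex.I_mul_I
  rw [this, Complex.ofReal_re]
  ring

lemma Siegel.exists_mul_sum_sq_le {τ : Matrix ι ι ℂ} (hτ : τ ∈ Siegel ι) :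
    ∃ c : ℝ, 0 < c ∧ ∀ v : ι → ℝ, c * ∑ i, v i ^ 2 ≤ ∑ i, ∑ j, v i * (τ i j).im * v j := by
  rcases isEmpty_or_nonempty ι with hι | hι
  · exact ⟨1, one_pos, fun v => by simp⟩
  set q : (ι → ℝ) → ℝ := fun v => ∑ i, ∑ j, v i * (τ i j).im * v j with hq
  have hcont : Continuous q := by fun_prop
  obtain ⟨w, hw, hmin⟩ := (isCompact_sphere (0 : ι → ℝ) 1).exists_isMinOn
    (NormedSpace.sphere_nonempty.mpr zero_le_one) hcont.continuousOn
  have hqw : 0 < q w := hτ.2 w fun h0 => by simp [h0] at hw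
  have hcard : (0 : ℝ) < Fintype.card ι := by exact_mod_cast Fintype.card_pos
  refine ⟨q w / Fintype.card ι, div_pos hqw hcard, fun v => ?_⟩
  have hsum : ∑ i, v i ^ 2 ≤ Fintype.card ι * ‖v‖ ^ 2 := by
    rw [← nsmul_eq_mul]
    refine Finset.sum_le_card_nsmul _ _ _ fun i _ => ?_
    rw [← sq_abs, ← Real.norm_eq_abs]
    exact pow_le_pow_left₀ (norm_nonneg _) (norm_le_pi_norm v i) 2
  have hhom : q w * ‖v‖ ^ 2 ≤ q v := by
    by_cases hv : v = 0
    · simp [hv, hq]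
    have hn : 0 < ‖v‖ := norm_pos_iff.mpr hv
    have h1 : q w ≤ q (‖v‖⁻¹ • v) := hmin (by simp [norm_smul, hn.ne'])
    have h2 : q (‖v‖⁻¹ • v) = (‖v‖ ^ 2)⁻¹ * q v := by
      simp only [hq, Pi.smul_apply, smul_eq_mul, Finset.mul_sum]
      refine Finset.sum_congr rfl fun i _ => Finset.sum_congr rfl fun j _ => ?_
      ring
    rw [h2] at h1
    rwa [← le_div_iff₀ (by positivity), div_eq_inv_mul]
  calc q w / Fintype.card ι * ∑ i, v i ^ 2
      ≤ q w / Fintype.card ι * (Fintype.card ι * ‖v‖ ^ 2) := by gcongr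
    _ = q w * ‖v‖ ^ 2 := by field_simp
    _ ≤ q v := hhom

lemma summable_thetaTerm {τ : Matrix ι ι ℂ} (hτ : τ ∈ Siegel ι) (m : Char2 ι) :
    Summable (thetaTerm m τ) := by
  classical
  obtain ⟨c, hc, hle⟩ := Siegel.exists_mul_sum_sq_le hτ
  refine Summable.of_norm_bounded
    (summable_prod_pi (f := fun i (n : ℤ) => Real.exp (-Real.pi * c * ((n : ℝ) + (m.1 i).val / 2) ^ 2))
      (fun i n => (Real.exp_pos _).le) fun i => summable_exp_neg_mul_add_sq hc _) fun n => ?_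
  rw [thetaTerm, Complex.norm_exp, ← Real.exp_sum, Real.exp_le_exp]
  set r : ι → ℝ := fun i => (n i : ℝ) + (m.1 i).val / 2 with hr
  have hcast : ∀ i, (n i : ℂ) + ((m.1 i).val : ℂ) / 2 = (r i : ℂ) := fun i => by
    simp only [hr]
    push_cast
    rfl
  have hre : (Real.pi * Complex.I *
      ((∑ i, ∑ j, ((n i : ℂ) + ((m.1 i).val : ℂ) / 2) * τ i j *
        ((n j : ℂ) + ((m.1 j).val : ℂ) / 2)) +
      ∑ i, ((n i : ℂ) + ((m.1 i).val : ℂ) / 2) * ((m.2 i).val : ℂ))).re =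
      -Real.pi * ∑ i, ∑ j, r i * (τ i j).im * r j := by
    simp only [hcast]
    rw [mul_assoc, Complex.re_ofReal_mul, Complex.I_mul_re, Complex.add_im]
    have h0 : ∀ i, ((r i : ℂ) * ((m.2 i).val : ℂ)).im = 0 := fun i => by
      rw [Complex.im_ofReal_mul, Complex.natCast_im, mul_zero]
    simp only [Complex.im_sum, h0, Complex.im_mul_ofReal, Complex.im_ofReal_mul,
      Finset.sum_const_zero, add_zero]
    ring
  rw [hre, ← Finset.mul_sum]
  have := hle r
  nlinarith [Real.pi_pos]

end Summability

section Inversion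

lemma tsum_exp_inversion {t : ℂ} (ht : 0 < t.im) (u : ℂ) (e d : ℤ) :
    ∑' a : ℤ, Complex.exp (Real.pi * Complex.I *
      (-((a + e / 2 : ℂ) - u) ^ 2 / t + (a + e / 2 : ℂ) * d)) =
    (-Complex.I * t) ^ (1 / 2 : ℂ) * Complex.exp (-(Real.pi * Complex.I * (d * e / 2))) *
      ∑' a : ℤ, Complex.exp (Real.pi * Complex.I *
        (t * (a + d / 2 : ℂ) ^ 2 + 2 * (a + d / 2 : ℂ) * u + (a + d / 2 : ℂ) * e)) := by
  have ht0 : t ≠ 0 := fun h => by simp [h] at ht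
  have hK : (-Complex.I * t) ^ (1 / 2 : ℂ) ≠ 0 := by
    simp [Complex.cpow_eq_zero_iff, ht0]
  set z : ℂ := u + e / 2 + t * d / 2 with hz
  have hR : ∑' a : ℤ, Complex.exp (Real.pi * Complex.I *
        (t * (a + d / 2 : ℂ) ^ 2 + 2 * (a + d / 2 : ℂ) * u + (a + d / 2 : ℂ) * e)) =
      Complex.exp (Real.pi * Complex.I * (t * d ^ 2 / 4 + d * u + d * e / 2)) *
        jacobiTheta₂ z t := by
    rw [jacobiTheta₂, ← tsum_mul_left]
    refine tsum_congr fun a => ?_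
    rw [jacobiTheta₂_term, ← Complex.exp_add]
    congr 1
    rw [hz]
    ring
  have hL : ∑' a : ℤ, Complex.exp (Real.pi * Complex.I *
      (-((a + e / 2 : ℂ) - u) ^ 2 / t + (a + e / 2 : ℂ) * d)) =
      Complex.exp (Real.pi * Complex.I * (-(e / 2 - u) ^ 2 / t + e * d / 2)) *
        jacobiTheta₂ ((z - e) / t) (-1 / t) := by
    rw [jacobiTheta₂, ← tsum_mul_left]
    refine tsum_congr fun a => ?_
    rw [jacobiTheta₂_term, ← Complex.exp_add]
    congr 1
    rw [hz]
    field_simp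
    ring
  have hper : jacobiTheta₂ (z - e) t = jacobiTheta₂ z t := by
    have hp : Function.Periodic (fun z => jacobiTheta₂ z t) 1 := fun z => jacobiTheta₂_add_left z t
    simpa using hp.sub_int_mul_eq (x := z) e
  have hfun : jacobiTheta₂ ((z - e) / t) (-1 / t) = (-Complex.I * t) ^ (1 / 2 : ℂ) *
      Complex.exp (Real.pi * Complex.I * ((z - e) ^ 2 / t)) * jacobiTheta₂ z t := by
    rw [← hper, jacobiTheta₂_functional_equation (z - e) t]
    have : Complex.exp (Real.pi * Complex.I * ((z - e) ^ 2 / t)) *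
        Complex.exp (-Real.pi * Complex.I * (z - e) ^ 2 / t) = 1 := by
      rw [← Complex.exp_add, ← Complex.exp_zero]
      congr 1
      ring
    generalize jacobiTheta₂ ((z - e) / t) (-1 / t) = θ
    generalize Complex.exp (Real.pi * Complex.I * ((z - e) ^ 2 / t)) = E at this ⊢
    generalize Complex.exp (-Real.pi * Complex.I * (z - e) ^ 2 / t) = E' at this ⊢
    generalize (-Complex.I * t) ^ (1 / 2 : ℂ) = K at hK ⊢
    field_simp
    linear_combination (-θ) * this
  have hexp : Complex.exp (Real.pi * Complex.I * (-(e / 2 - u) ^ 2 / t + e * d / 2)) *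
      Complex.exp (Real.pi * Complex.I * ((z - e) ^ 2 / t)) =
      Complex.exp (-(Real.pi * Complex.I * (d * e / 2))) *
        Complex.exp (Real.pi * Complex.I * (t * d ^ 2 / 4 + d * u + d * e / 2)) := by
    rw [← Complex.exp_add, ← Complex.exp_add, hz]
    congr 1
    field_simp
    ring
  rw [hL, hR, hfun]
  linear_combination ((-Complex.I * t) ^ (1 / 2 : ℂ) * jacobiTheta₂ z t) * hexp

end Inversion

section PartialInversion

variable {ι : Type} [DecidableEq ι]

lemma tsum_eq_mul_tsum_of_update {f g : (ι → ℤ) → ℂ} (hf : Summable f) (hg : Summable g) (k : ι)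
    {c : ℂ} (h : ∀ n, ∑' a : ℤ, f (Function.update n k a) = c * ∑' a : ℤ, g (Function.update n k a)) :
    ∑' n, f n = c * ∑' n, g n := by
  set e : ({j // j ≠ k} → ℤ) × ℤ ≃ (ι → ℤ) :=
    (Equiv.prodComm _ _).trans (Equiv.funSplitAt k ℤ).symm with he
  have hupd : ∀ w a, e (w, a) = Function.update (e (w, 0)) k a := fun w a => by
    ext j
    by_cases hj : j = k
    · subst hj
      simp [he, Equiv.funSplitAt, Equiv.piSplitAt]
    · simp [he, Equiv.funSplitAt, Equiv.piSplitAt, hj]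
  have hsplit : ∀ f : (ι → ℤ) → ℂ, Summable f →
      ∑' n, f n = ∑' w, ∑' a : ℤ, f (Function.update (e (w, 0)) k a) := fun f hf => by
    rw [← e.tsum_eq, Summable.tsum_prod (f := fun p => f (e p)) (e.summable_iff.mpr hf)]
    simp only [← hupd]
  rw [hsplit f hf, hsplit g hg, ← tsum_mul_left]
  exact tsum_congr fun w => h _

variable [Fintype ι]

lemma sum_sum_eq_add_erase {τ : Matrix ι ι ℂ} (hτ : τ.IsSymm) (r : ι → ℂ) (k : ι) :
    ∑ i, ∑ j, r i * τ i j * r j = τ k k * r k ^ 2 + 2 * r k * ∑ j ∈ Finset.univ.erase k, τ k j * r j +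
      ∑ i ∈ Finset.univ.erase k, ∑ j ∈ Finset.univ.erase k, r i * τ i j * r j := by
  have h : ∀ f : ι → ℂ, ∑ i, f i = f k + ∑ i ∈ Finset.univ.erase k, f i := fun f =>
    (Finset.add_sum_erase _ f (Finset.mem_univ k)).symm
  rw [h]
  simp only [h fun j => r _ * τ _ j * r j, Finset.sum_add_distrib]
  have h1 : ∑ i ∈ Finset.univ.erase k, r i * τ i k * r k =
      r k * ∑ j ∈ Finset.univ.erase k, τ k j * r j := by
    rw [Finset.mul_sum]
    refine Finset.sum_congr rfl fun i _ => ?_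
    rw [hτ.apply k i]
    ring
  have h2 : ∑ j ∈ Finset.univ.erase k, r k * τ k j * r j =
      r k * ∑ j ∈ Finset.univ.erase k, τ k j * r j := by
    rw [Finset.mul_sum]
    exact Finset.sum_congr rfl fun i _ => by ring
  rw [h1, h2]
  ring

lemma thetaTerm_update {τ : Matrix ι ι ℂ} (hτ : τ.IsSymm) (m : Char2 ι) (n : ι → ℤ) (k : ι) (a : ℤ)
    {r : ι → ℂ} (hr : ∀ j ≠ k, r j = (n j : ℂ) + ((m.1 j).val : ℂ) / 2) :
    thetaTerm m τ (Function.update n k a) = Complex.exp (Real.pi * Complex.I *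
      (τ k k * ((a : ℂ) + ((m.1 k).val : ℂ) / 2) ^ 2 +
        2 * ((a : ℂ) + ((m.1 k).val : ℂ) / 2) * (∑ j ∈ Finset.univ.erase k, τ k j * r j) +
        ((a : ℂ) + ((m.1 k).val : ℂ) / 2) * ((m.2 k).val : ℂ) +
        (∑ i ∈ Finset.univ.erase k, ∑ j ∈ Finset.univ.erase k, r i * τ i j * r j) +
        ∑ i ∈ Finset.univ.erase k, r i * ((m.2 i).val : ℂ))) := by
  have hr' : ∀ j ∈ Finset.univ.erase k,
      ((Function.update n k a j : ℤ) : ℂ) + ((m.1 j).val : ℂ) / 2 = r j := fun j hj => by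
    rw [Function.update_of_ne (Finset.ne_of_mem_erase hj), hr j (Finset.ne_of_mem_erase hj)]
  rw [thetaTerm, sum_sum_eq_add_erase hτ
    (fun i => ((Function.update n k a i : ℤ) : ℂ) + ((m.1 i).val : ℂ) / 2) k,
    ← Finset.add_sum_erase _ _ (Finset.mem_univ k), Function.update_self,
    Finset.sum_congr rfl fun j hj => by rw [hr' j hj],
    Finset.sum_congr rfl fun i hi => Finset.sum_congr rfl fun j hj => by rw [hr' i hi, hr' j hj],
    Finset.sum_congr (f := fun i => _ * ((m.2 i).val : ℂ)) rfl fun i hi => by rw [hr' i hi]]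
  congr 2
  ring

/-- The involution of the characteristics interchanging the coordinates `ε k` and `δ k`. -/
def swapCoord (k : ι) (m : Char2 ι) : Char2 ι :=
  (Function.update m.1 k (m.2 k), Function.update m.2 k (m.1 k))

lemma thetaConst_inversion {τ τ' : Matrix ι ι ℂ} (hτ : τ ∈ Siegel ι) (hτ' : τ' ∈ Siegel ι) {k : ι}
    (ht : 0 < (τ k k).im) (hkk : τ' k k = -1 / τ k k) (hkj : ∀ j ≠ k, τ' k j = τ k j / τ k k)
    (hij : ∀ i ≠ k, ∀ j ≠ k, τ' i j = τ i j - τ k i * τ k j / τ k k) (m : Char2 ι) :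
    thetaConst m τ' = (-Complex.I * τ k k) ^ (1 / 2 : ℂ) *
      (if m.1 k = 1 ∧ m.2 k = 1 then -Complex.I else 1) * thetaConst (swapCoord k m) τ := by
  have ht0 : τ k k ≠ 0 := fun h => by simp [h] at ht
  rw [thetaConst_eq_tsum, thetaConst_eq_tsum]
  refine tsum_eq_mul_tsum_of_update (summable_thetaTerm hτ' m)
    (summable_thetaTerm hτ (swapCoord k m)) k fun n => ?_
  set r : ι → ℂ := fun j => (n j : ℂ) + ((m.1 j).val : ℂ) / 2 with hr
  have hr' : ∀ j ≠ k, r j = (n j : ℂ) + (((swapCoord k m).1 j).val : ℂ) / 2 := fun j hj => by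
    simp only [swapCoord, Function.update_of_ne hj, hr]
  set U := ∑ j ∈ Finset.univ.erase k, τ k j * r j with hU
  have hU' : ∑ j ∈ Finset.univ.erase k, τ' k j * r j = U / τ k k := by
    rw [hU, Finset.sum_div]
    refine Finset.sum_congr rfl fun j hj => ?_
    rw [hkj j (Finset.ne_of_mem_erase hj)]
    ring
  set Q := ∑ i ∈ Finset.univ.erase k, ∑ j ∈ Finset.univ.erase k, r i * τ i j * r j
  have hQ' : ∑ i ∈ Finset.univ.erase k, ∑ j ∈ Finset.univ.erase k, r i * τ' i j * r j =
      Q - U ^ 2 / τ k k := by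
    rw [pow_two, hU, Finset.sum_mul_sum, Finset.sum_div, ← Finset.sum_sub_distrib]
    refine Finset.sum_congr rfl fun i hi => ?_
    rw [Finset.sum_div, ← Finset.sum_sub_distrib]
    refine Finset.sum_congr rfl fun j hj => ?_
    rw [hij i (Finset.ne_of_mem_erase hi) j (Finset.ne_of_mem_erase hj)]
    ring
  set R := ∑ i ∈ Finset.univ.erase k, r i * ((m.2 i).val : ℂ) with hR
  have hR' : ∑ i ∈ Finset.univ.erase k, r i * (((swapCoord k m).2 i).val : ℂ) = R :=
    Finset.sum_congr rfl fun i hi => by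
      simp only [swapCoord, Function.update_of_ne (Finset.ne_of_mem_erase hi)]
  have hL : ∀ a : ℤ, thetaTerm m τ' (Function.update n k a) =
      Complex.exp (Real.pi * Complex.I * (Q + R)) * Complex.exp (Real.pi * Complex.I *
        (-((a + ((m.1 k).val : ℤ) / 2 : ℂ) - U) ^ 2 / τ k k +
          (a + ((m.1 k).val : ℤ) / 2 : ℂ) * ((m.2 k).val : ℤ))) := fun a => by
    rw [thetaTerm_update hτ'.1 m n k a (r := r) fun j _ => rfl, hU', hQ', ← hR, hkk, ← Complex.exp_add]
    congr 1
    push_cast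
    field_simp
    ring
  have hRt : ∀ a : ℤ, thetaTerm (swapCoord k m) τ (Function.update n k a) =
      Complex.exp (Real.pi * Complex.I * (Q + R)) * Complex.exp (Real.pi * Complex.I *
        (τ k k * (a + ((m.2 k).val : ℤ) / 2 : ℂ) ^ 2 + 2 * (a + ((m.2 k).val : ℤ) / 2 : ℂ) * U +
          (a + ((m.2 k).val : ℤ) / 2 : ℂ) * ((m.1 k).val : ℤ))) := fun a => by
    rw [thetaTerm_update hτ.1 (swapCoord k m) n k a hr', hR', ← Complex.exp_add]
    simp only [swapCoord, Function.update_self]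
    congr 1
    push_cast
    ring
  have hc : Complex.exp (-(Real.pi * Complex.I * (((m.2 k).val : ℤ) * ((m.1 k).val : ℤ) / 2))) =
      if m.1 k = 1 ∧ m.2 k = 1 then -Complex.I else 1 := by
    rcases zmod_two_eq_zero_or_one (m.1 k) with h1 | h1 <;>
      rcases zmod_two_eq_zero_or_one (m.2 k) with h2 | h2 <;>
      simp [h1, h2, ZMod.val_one]
    rw [show Real.pi * Complex.I * 2⁻¹ = Real.pi / 2 * Complex.I by ring, Complex.exp_neg,
      Complex.exp_pi_div_two_mul_I, Complex.inv_I]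
  simp only [hL, hRt, tsum_mul_left]
  rw [tsum_exp_inversion ht, hc]
  ring

end PartialInversion

section SformInversion

variable {ι : Type} [DecidableEq ι]

lemma swapCoord_involutive (k : ι) : Function.Involutive (swapCoord (ι := ι) k) := fun m => by
  simp [swapCoord]

/-- The interchange of the coordinates `ε k` and `δ k` as a linear map. -/
def swapCoordLinear (k : ι) : Char2 ι →ₗ[ZMod 2] Char2 ι where
  toFun := swapCoord k
  map_add' m n := by simp [swapCoord, Function.update_add]
  map_smul' c m := by simp [swapCoord, ← Function.update_smul]

variable [Fintype ι]

lemma Siegel.im_diag_pos {τ : Matrix ι ι ℂ} (hτ : τ ∈ Siegel ι) (k : ι) : 0 < (τ k k).im := by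
  have h := hτ.2 (Pi.single k 1) (by simp)
  simpa [Pi.single_apply] using h

lemma Sform_inversion {i : ℕ} (hi : i ≤ 4) {τ τ' : Matrix ι ι ℂ} (hτ : τ ∈ Siegel ι)
    (hτ' : τ' ∈ Siegel ι) {k : ι} (hkk : τ' k k = -1 / τ k k)
    (hkj : ∀ j ≠ k, τ' k j = τ k j / τ k k)
    (hij : ∀ i ≠ k, ∀ j ≠ k, τ' i j = τ i j - τ k i * τ k j / τ k k) :
    Sform ι i (2 ^ (4 - i)) τ' = τ k k ^ 8 * Sform ι i (2 ^ (4 - i)) τ := by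
  rw [Sform_eq_mul_of_thetaConst (swapCoord_involutive k) (swapCoordLinear k) 0
    (fun m => (add_zero _).symm)
    (thetaConst_inversion hτ hτ' (Siegel.im_diag_pos hτ k) hkk hkj hij) fun W hW => ?_]
  · congr 1
    have h16 : 2 ^ i * 2 ^ (4 - i) = 2 * 8 := by
      rw [← pow_add, Nat.add_sub_cancel' hi]
      norm_num
    have hsq : ((-Complex.I * τ k k) ^ (1 / 2 : ℂ)) ^ 2 = -Complex.I * τ k k := by
      rw [one_div]
      exact Complex.cpow_nat_inv_pow (-Complex.I * τ k k) two_ne_zero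
    have hI : (-Complex.I) ^ 8 = 1 := by
      rw [show 8 = 2 * 4 from rfl, pow_mul, neg_sq, Complex.I_sq]
      norm_num
    rw [h16, pow_mul, hsq, mul_pow, hI, one_mul]
  · refine IsEmptyOrAffine.prod_ite_pow_eq_one (r := 2) hi ?_ ?_
    · rw [← Finset.filter_filter]
      exact (hW.isEmptyOrAffine.filter (epsCoord k) 1).filter (delCoord k) 1
    · norm_num [pow_succ]

end SformInversion

namespace Siegel

open Matrix SymplecticGroup

variable {g : ℕ}

lemma act_translation (B : Matrix (Fin g) (Fin g) ℤ) (hB : B.IsSymm)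
    (τ : Matrix (Fin g) (Fin g) ℂ) :
    act (translation B hB) τ = τ + B.map (Int.cast : ℤ → ℂ) := by
  simp [act, translation, symplAction]

lemma factor_translation (B : Matrix (Fin g) (Fin g) ℤ) (hB : B.IsSymm)
    (τ : Matrix (Fin g) (Fin g) ℂ) : factor (translation B hB) τ = 1 := by
  simp [factor, translation, denom]

lemma factor_inversion (k : Fin g) (τ : Matrix (Fin g) (Fin g) ℂ) :
    factor (inversion {k}) τ = updateRow 1 k (τ k) := by
  ext i j
  by_cases hi : i = k
  · subst hi
    simp [factor, inversion, denom, diagonal_map, diagonal_apply]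
  · simp [factor, inversion, denom, diagonal_map, hi, diagonal_apply, one_apply]

lemma det_factor_inversion (k : Fin g) (τ : Matrix (Fin g) (Fin g) ℂ) :
    (factor (inversion {k}) τ).det = τ k k := by
  rw [factor_inversion, ← cramer_transpose_apply, transpose_one, cramer_one]
  rfl

lemma act_inversion_mul (k : Fin g) {τ : Matrix (Fin g) (Fin g) ℂ} (hτ : τ ∈ Siegel (Fin g))
    (i j : Fin g) : act (inversion {k}) τ i k * τ k j +
      (if j = k then 0 else act (inversion {k}) τ i j) =
      if i = k then (if j = k then -1 else 0) else τ i j := by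
  have h : act (inversion {k}) τ * factor (inversion {k}) τ =
      denom (inversion {k}).1.toBlocks₁₁ (inversion {k}).1.toBlocks₁₂ τ := by
    rw [act, symplAction, Matrix.mul_assoc, nonsing_inv_mul _ (isUnit_det_factor _ hτ),
      Matrix.mul_one]
  have h' := congr_fun (congr_fun h i) j
  rw [factor_inversion] at h'
  convert h' using 1
  · rw [Matrix.mul_apply, ← Finset.add_sum_erase _ _ (Finset.mem_univ k), updateRow_self]
    congr 1
    split_ifs with hj
    · refine (Finset.sum_eq_zero fun l hl => ?_).symm
      rw [updateRow_ne (Finset.ne_of_mem_erase hl), hj, one_apply_ne (Finset.ne_of_mem_erase hl),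
        mul_zero]
    · rw [Finset.sum_eq_single_of_mem j (Finset.mem_erase.mpr ⟨hj, Finset.mem_univ j⟩),
        updateRow_ne hj, one_apply_eq, mul_one]
      intro l hl hlj
      rw [updateRow_ne (Finset.ne_of_mem_erase hl), one_apply_ne hlj, mul_zero]
  · by_cases hi : i = k
    · subst hi
      simp [inversion, denom, diagonal_map, diagonal_apply, eq_comm]
    · simp [inversion, denom, diagonal_map, hi, diagonal_apply]

lemma inversion_mem_modularSubgroup {i : ℕ} (hi : i ≤ 4) (k : Fin g) :
    inversion {k} ∈ modularSubgroup (Sform (Fin g) i (2 ^ (4 - i))) 8 := by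
  intro τ hτ
  have h0 : τ k k ≠ 0 := fun h => by simpa [h] using im_diag_pos hτ k
  have h := act_inversion_mul k hτ
  rw [det_factor_inversion]
  have hik : ∀ i ≠ k, act (inversion {k}) τ i k = τ k i / τ k k := fun i hi => by
    have := h i k
    rw [if_pos rfl, if_neg hi, add_zero, hτ.1.apply k i] at this
    exact eq_div_of_mul_eq h0 this
  have hkk : act (inversion {k}) τ k k = -1 / τ k k := by
    have := h k k
    rw [if_pos rfl, if_pos rfl, if_pos rfl, add_zero] at this
    exact eq_div_of_mul_eq h0 this
  refine Sform_inversion hi hτ (act_mem _ hτ) hkk (fun j hj => ?_) fun i hi j hj => ?_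
  · rw [← (act_mem (inversion {k}) hτ).1.apply, hik j hj]
  · have := h i j
    rw [if_neg hj, if_neg hi, hik i hi] at this
    linear_combination this

lemma translation_mem_modularSubgroup {i : ℕ} (hi : i ≤ 4) (k l : Fin g) :
    translation (elemSymm k l 1) (elemSymm_isSymm k l 1) ∈
      modularSubgroup (Sform (Fin g) i (2 ^ (4 - i))) 8 := by
  intro τ _
  rw [act_translation, factor_translation, det_one, one_pow, one_mul]
  by_cases hkl : k = l
  · subst hkl
    exact Sform_add_elemSymm_self hi τ k
  · exact Sform_add_elemSymm hi τ hkl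

end Siegel

lemma IsSymplectic.fromBlocks_mem {g : ℕ} {A B C D : Matrix (Fin g) (Fin g) ℤ}
    (h : IsSymplectic A B C D) : Matrix.fromBlocks A B C D ∈ Matrix.symplecticGroup (Fin g) ℤ := by
  have hJ : symplJ g = -Matrix.J (Fin g) ℤ := by
    simp [symplJ, Matrix.J, Matrix.fromBlocks_neg]
  rw [IsSymplectic, hJ, Matrix.mul_neg, Matrix.neg_mul, neg_inj] at h
  exact SymplecticGroup.mem_iff.mpr h

/-- `S_{i,2^{4−i}}^g` is a modular form of weight 8 with respect to the full
symplectic group `Sp(2g,ℤ)`. -/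
theorem Sform_modular (g i : ℕ) (hg : 1 ≤ g) (hi : i ≤ min g 4)
    (A B C D : Matrix (Fin g) (Fin g) ℤ) (hγ : IsSymplectic A B C D)
    (τ : Matrix (Fin g) (Fin g) ℂ) (hτ : τ ∈ Siegel (Fin g)) :
    Sform (Fin g) i (2 ^ (4 - i)) (symplAction A B C D τ) =
      (C.map (Int.cast : ℤ → ℂ) * τ + D.map (Int.cast : ℤ → ℂ)).det ^ 8 *
        Sform (Fin g) i (2 ^ (4 - i)) τ := by
  have hi4 : i ≤ 4 := hi.trans (min_le_right g 4)
  have htop := SymplecticGroup.eq_top_of_translation_mem_of_inversion_mem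
    (H := Siegel.modularSubgroup (Sform (Fin g) i (2 ^ (4 - i))) 8)
    (Siegel.translation_mem_modularSubgroup hi4) (Siegel.inversion_mem_modularSubgroup hi4)
  have hmem : (⟨Matrix.fromBlocks A B C D, hγ.fromBlocks_mem⟩ : Matrix.symplecticGroup (Fin g) ℤ) ∈
      Siegel.modularSubgroup (Sform (Fin g) i (2 ^ (4 - i))) 8 := htop ▸ Subgroup.mem_top _
  simpa only [Siegel.act, Siegel.factor, Siegel.denom, Matrix.toBlocks_fromBlocks₁₁,
    Matrix.toBlocks_fromBlocks₁₂, Matrix.toBlocks_fromBlocks₂₁, Matrix.toBlocks_fromBlocks₂₂]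
    using hmem τ hτ
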